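/- Let p, q, σ₁, σ₂ ∈ (0,∞], α₁, α₂ ∈ ℝ, α₃ ≥ 0, {t_k} ∈ 𝒳^{α₃}_{α,σ,p} with σ₂ ≥ p (α = (α₁,α₂), σ = (σ₁,σ₂)). Let φ₀ ∈ D(ℝⁿ) with ∫φ₀ = 1, φ := φ₀ − 2^{−n}φ₀(·/2) with L_φ + 1 > α₂, let A > 0, and let ψ₀, ψ ∈ C_c^∞(ℝⁿ) with L_ψ + 1 > A; set ψ_j := 2^{jn}ψ(2^j·) for j ≥ 1 (the family starts with ψ₀). Let {g^k}_{k∈ℕ₀} be a sequence of measurable, locally bounded functions on ℝⁿ, put G^j_A(m) := sup_{k ≥ j} 2^{A(j−k)} sup_{y ∈ Q_{j,m}} |g^k(y)|, and assume Σ_{j=0}^{∞} (Σ_{m∈ℤⁿ} t_{j,m}^p (G^j_A(m))^p)^{q/p} < ∞ (sup-modifications for p = ∞ or q = ∞). Then the series Σ_{j=0}^{∞} ψ_j ∗ g^j converges in S'_e and ‖Σ_{j=0}^{∞} ψ_j ∗ g^j | B^{φ₀}_{p,q}({t_k})‖ ≤ C (Σ_{j=0}^{∞}(Σ_{m∈ℤⁿ}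 t_{j,m}^p (G^j_A(m))^p)^{q/p})^{1/q}, with C > 0 independent of {g^k}. -/

import Mathlib

open MeasureTheory ENNReal Filter Topology

noncomputable section

def lqNorm (q : ℝ≥0∞) (a : ℕ → ℝ≥0∞) : ℝ≥0∞ :=
  if q = ∞ then ⨆ k, a k else (∑' k, a k ^ q.toReal) ^ (1 / q.toReal)

def lpSum {ι : Type*} (p : ℝ≥0∞) (a : ι → ℝ≥0∞) : ℝ≥0∞ :=
  if p = ∞ then ⨆ m, a m else (∑' m, a m ^ p.toReal) ^ (1 / p.toReal)

def dyadicCube (n k : ℕ) (m : Fin n → ℤ) : Set (Fin n → ℝ) :=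
  {x | ∀ i, (m i : ℝ) / 2 ^ k ≤ x i ∧ x i ≤ ((m i : ℝ) + 1) / 2 ^ k}

def dilatedCube (n : ℕ) (c : ℝ) (k : ℕ) (m : Fin n → ℤ) : Set (Fin n → ℝ) :=
  {x | ∀ i, |x i - ((m i : ℝ) + 1 / 2) / 2 ^ k| ≤ c / (2 * 2 ^ k)}

def tkm (n : ℕ) (p : ℝ≥0∞) (t : ℕ → (Fin n → ℝ) → ℝ) (k : ℕ) (m : Fin n → ℤ) : ℝ≥0∞ :=
  eLpNorm (t k) p (volume.restrict (dyadicCube n k m))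

def PAdmissible (n : ℕ) (p : ℝ≥0∞) (t : ℕ → (Fin n → ℝ) → ℝ) : Prop :=
  (∀ k, Measurable (t k)) ∧ (∀ k, ∀ᵐ x : Fin n → ℝ, 0 < t k x) ∧
    ∀ k m, tkm n p t k m < ∞

def MemX (n : ℕ) (p σ₁ σ₂ : ℝ≥0∞) (α₁ α₂ α₃ : ℝ) (t : ℕ → (Fin n → ℝ) → ℝ) : Prop :=
  PAdmissible n p t ∧
  (∃ C₁ : ℝ, 0 < C₁ ∧ ∀ k j : ℕ, k ≤ j → ∀ m : Fin n → ℤ,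
    (((2 : ℝ≥0∞) ^ (k * n)) ^ p⁻¹.toReal * tkm n p t k m) *
      (((2 : ℝ≥0∞) ^ (k * n)) ^ σ₁⁻¹.toReal *
        eLpNorm (fun x => (t j x)⁻¹) σ₁ (volume.restrict (dyadicCube n k m)))
      ≤ ENNReal.ofReal (C₁ * 2 ^ (α₁ * ((k : ℝ) - (j : ℝ))))) ∧
  (∃ C₂ : ℝ, 0 < C₂ ∧ ∀ k j : ℕ, k ≤ j → ∀ m : Fin n → ℤ,
    ((2 : ℝ≥0∞) ^ (k * n)) ^ σ₂⁻¹.toReal *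
        eLpNorm (t j) σ₂ (volume.restrict (dyadicCube n k m))
      ≤ ENNReal.ofReal (C₂ * 2 ^ (α₂ * ((j : ℝ) - (k : ℝ)))) *
        (((2 : ℝ≥0∞) ^ (k * n)) ^ p⁻¹.toReal * tkm n p t k m)) ∧
  (∀ k m, 0 < tkm n p t k m) ∧
  (∀ (k : ℕ) (m m' : Fin n → ℤ), (∀ i, |m i - m' i| ≤ 1) →
    tkm n p t k m ≤ ENNReal.ofReal (2 ^ α₃) * tkm n p t k m')

def tbar (n : ℕ) (p : ℝ≥0∞) (t : ℕ → (Fin n → ℝ) → ℝ) (k : ℕ) (x : Fin n → ℝ) : ℝ :=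
  (2 : ℝ) ^ (((k * n : ℕ) : ℝ) / p.toReal) * (tkm n p t k fun i => ⌊x i * 2 ^ k⌋).toReal

abbrev Dstrb (n : ℕ) := ((Fin n → ℝ) → ℝ) →ₗ[ℝ] ℝ

def distConv (n : ℕ) (f : Dstrb n) (φ : (Fin n → ℝ) → ℝ) (x : Fin n → ℝ) : ℝ :=
  f fun y => φ (x - y)

def IsTestFun (n : ℕ) (g : (Fin n → ℝ) → ℝ) : Prop :=
  ContDiff ℝ (⊤ : ℕ∞) g ∧ HasCompactSupport g

def phiOf (n : ℕ) (φ₀ : (Fin n → ℝ) → ℝ) (x : Fin n → ℝ) : ℝ :=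
  φ₀ x - (2 : ℝ)⁻¹ ^ n * φ₀ ((2 : ℝ)⁻¹ • x)

def phiFam (n : ℕ) (φ₀ : (Fin n → ℝ) → ℝ) : ℕ → (Fin n → ℝ) → ℝ
  | 0 => φ₀
  | k + 1 => fun x => (2 : ℝ) ^ ((k + 1) * n) * phiOf n φ₀ ((2 : ℝ) ^ (k + 1) • x)

def kernFam (n : ℕ) (ψ₀ ψ : (Fin n → ℝ) → ℝ) : ℕ → (Fin n → ℝ) → ℝ
  | 0 => ψ₀
  | k + 1 => fun x => (2 : ℝ) ^ ((k + 1) * n) * ψ ((2 : ℝ) ^ (k + 1) • x)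

def besovNorm (n : ℕ) (p q : ℝ≥0∞) (t : ℕ → (Fin n → ℝ) → ℝ)
    (φ₀ : (Fin n → ℝ) → ℝ) (f : Dstrb n) : ℝ≥0∞ :=
  lqNorm q fun k =>
    eLpNorm (fun x => t k x * distConv n f (phiFam n φ₀ k) x) p volume

def seSeminorm (n : ℕ) (N : ℕ) (g : (Fin n → ℝ) → ℝ) : ℝ≥0∞ :=
  ⨆ x : Fin n → ℝ, ENNReal.ofReal
    (Real.exp (N * ‖x‖) * ∑ i ∈ Finset.range (N + 1), ‖iteratedFDeriv ℝ i g x‖)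

def MemSe' (n : ℕ) (f : Dstrb n) : Prop :=
  ∃ (C : ℝ) (N : ℕ), 0 < C ∧ ∀ g : (Fin n → ℝ) → ℝ, ContDiff ℝ (⊤ : ℕ∞) g →
    ENNReal.ofReal |f g| ≤ ENNReal.ofReal C * seSeminorm n N g

def MomentsVanish (n : ℕ) (L : ℤ) (ψ : (Fin n → ℝ) → ℝ) : Prop :=
  ∀ β : Fin n → ℕ, ((∑ i, β i : ℕ) : ℤ) ≤ L → (∫ x, (∏ i, x i ^ β i) * ψ x) = 0


/-- The maximal function `G^j_A(m)` of a sequence of functions. -/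
def seqMax (n : ℕ) (g : ℕ → (Fin n → ℝ) → ℝ) (A : ℝ) (j : ℕ) (m : Fin n → ℤ) : ℝ≥0∞ :=
  ⨆ (k : ℕ) (_ : j ≤ k), ⨆ y ∈ dyadicCube n j m,
    ENNReal.ofReal ((2 : ℝ) ^ (A * ((j : ℝ) - (k : ℝ))) * |g k y|)


/-- Multilinear forms on the diagonal integrate to zero against a function with
vanishing moments. -/
lemma integral_diag_zero {n : ℕ} {L : ℤ} {ψ : (Fin n → ℝ) → ℝ} (hψ : IsTestFun n ψ)
    (hm : MomentsVanish n L ψ) (k : ℕ) (hk : (k : ℤ) ≤ L)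
    (T : ContinuousMultilinearMap ℝ (fun _ : Fin k => (Fin n → ℝ)) ℝ) :
    Integrable (fun w => ψ w * T (fun _ => w)) ∧ (∫ w, ψ w * T (fun _ => w)) = 0 := by
  have hT : ∀ w : Fin n → ℝ, T (fun _ => w) =
      ∑ r : Fin k → Fin n, (∏ l, w (r l)) * T (fun l => Pi.single (r l) 1) := by
    intro w
    have h1 : (fun _ : Fin k => w) = fun _ : Fin k => ∑ a : Fin n, w a • (Pi.single a (1 : ℝ) : Fin n → ℝ) := by
      funext _ b
      simp [Finset.sum_apply, Pi.single_apply]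
    rw [h1]
    rw [ContinuousMultilinearMap.map_sum]
    refine Finset.sum_congr rfl fun r _ => ?_
    rw [ContinuousMultilinearMap.map_smul_univ]
    simp
  have hint : ∀ r : Fin k → Fin n,
      Integrable (fun w : Fin n → ℝ => ψ w * ((∏ l, w (r l)) * T (fun l => Pi.single (r l) 1))) := by
    intro r
    apply Continuous.integrable_of_hasCompactSupport
    · have := hψ.1.continuous
      fun_prop
    · exact hψ.2.mul_right
  constructor
  · simp_rw [hT, Finset.mul_sum]
    exact integrable_finsetSum _ fun r _ => hint r
  · simp_rw [hT, Finset.mul_sum]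
    rw [integral_finsetSum _ fun r _ => hint r]
    refine Finset.sum_eq_zero fun r _ => ?_
    have h2 : ∀ w : Fin n → ℝ, ∏ l, w (r l) = ∏ a, w a ^ (Finset.univ.filter fun l => r l = a).card := by
      intro w
      rw [← Finset.prod_fiberwise Finset.univ r]
      refine Finset.prod_congr rfl fun a _ => ?_
      rw [Finset.prod_congr rfl (g := fun _ => w a)]
      · simp
      · intro l hl
        rw [(Finset.mem_filter.1 hl).2]
    have h3 := hm (fun a => (Finset.univ.filter fun l => r l = a).card) (by
      have : ∑ a, (Finset.univ.filter fun l => r l = a).card = k := by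
        rw [← Finset.card_eq_sum_card_fiberwise (f := r) (s := Finset.univ) (t := Finset.univ) (by simp)]
        simp
      rw [this]; exact hk)
    simp_rw [h2]
    have : ∀ w : Fin n → ℝ, ψ w * ((∏ a, w a ^ (Finset.univ.filter fun l => r l = a).card) *
        T (fun l => Pi.single (r l) 1)) = ((∏ a, w a ^ (Finset.univ.filter fun l => r l = a).card) * ψ w) *
        T (fun l => Pi.single (r l) 1) := fun w => by ring
    simp_rw [this]
    rw [integral_mul_const, h3, zero_mul]

/-- Taylor remainder bound. -/
lemma taylor_bound {n : ℕ} (M : ℕ) {h : (Fin n → ℝ) → ℝ} (hh : ContDiff ℝ (⊤ : ℕ∞) h)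
    {R B : ℝ} (hB : ∀ w, ‖w‖ ≤ R → ‖iteratedFDeriv ℝ M h w‖ ≤ B) (w : Fin n → ℝ) (hw : ‖w‖ ≤ R) :
    |h w - ∑ k ∈ Finset.range M, (k.factorial : ℝ)⁻¹ • iteratedFDeriv ℝ k h 0 (fun _ => w)| ≤ B * R ^ M := by
  have hR : 0 ≤ R := (norm_nonneg _).trans hw
  have hB0 : 0 ≤ B := (norm_nonneg _).trans (hB w hw)
  cases M with
  | zero =>
    simpa using hB w hw
  | succ m =>
    have := map_add_eq_sum_add_integral_iteratedFDeriv (f := h) (x := 0) (y := w) (n := m)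
      (fun t _ => hh.contDiffAt.of_le (by exact_mod_cast le_top))
    simp only [zero_add] at this
    rw [this, add_sub_cancel_left]
    have hI : ‖∫ t in (0 : ℝ)..1, (1 - t) ^ m • iteratedFDeriv ℝ (m + 1) h (t • w) (fun _ => w)‖
        ≤ (B * R ^ (m + 1)) * |(1 : ℝ) - 0| := by
      apply intervalIntegral.norm_integral_le_of_norm_le_const
      intro t ht
      rw [Set.uIoc_of_le zero_le_one] at ht
      rw [norm_smul]
      have e1 : ‖(1 - t) ^ m‖ ≤ 1 := by
        rw [norm_pow]
        apply pow_le_one₀ (norm_nonneg _)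
        rw [Real.norm_eq_abs, abs_le]; constructor <;> linarith [ht.1, ht.2]
      have e2 : ‖t • w‖ ≤ R := by
        rw [norm_smul, Real.norm_eq_abs, abs_of_pos ht.1]
        nlinarith [norm_nonneg w, ht.2]
      have e3 : ‖iteratedFDeriv ℝ (m + 1) h (t • w) (fun _ => w)‖ ≤ B * R ^ (m + 1) := by
        refine (ContinuousMultilinearMap.le_opNorm _ _).trans ?_
        simp only [Finset.prod_const, Finset.card_univ, Fintype.card_fin]
        gcongr
        exact hB _ e2
      calc _ ≤ 1 * (B * R ^ (m + 1)) := by gcongr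
        _ = _ := one_mul _
    rw [← Real.norm_eq_abs, norm_smul]
    have e4 : ‖((m.factorial : ℝ))⁻¹‖ ≤ 1 := by
      rw [norm_inv, Real.norm_natCast]
      apply inv_le_one_of_one_le₀
      exact_mod_cast Nat.succ_le_of_lt (Nat.factorial_pos m)
    simp only [sub_zero, abs_one, mul_one] at hI
    calc _ ≤ 1 * (B * R ^ (m + 1)) := by gcongr
        _ = _ := one_mul _

/-- Moment cancellation estimate. -/
lemma moment_bound {n : ℕ} {L : ℤ} {ψ : (Fin n → ℝ) → ℝ} (hψ : IsTestFun n ψ)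
    (hm : MomentsVanish n L ψ) (M : ℕ) (hM : (M : ℤ) ≤ L + 1) {R : ℝ}
    (hR : ∀ w, R < ‖w‖ → ψ w = 0)
    {h : (Fin n → ℝ) → ℝ} (hh : ContDiff ℝ (⊤ : ℕ∞) h)
    {B : ℝ} (hB : ∀ w, ‖w‖ ≤ R → ‖iteratedFDeriv ℝ M h w‖ ≤ B) :
    |∫ w, ψ w * h w| ≤ (∫ w, |ψ w|) * (B * R ^ M) := by
  set P : (Fin n → ℝ) → ℝ := fun w =>
    ∑ k ∈ Finset.range M, (k.factorial : ℝ)⁻¹ • iteratedFDeriv ℝ k h 0 (fun _ => w) with hP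
  have hk : ∀ k ∈ Finset.range M, Integrable (fun w => ψ w * ((k.factorial : ℝ)⁻¹ • iteratedFDeriv ℝ k h 0 (fun _ => w)))
      ∧ ∫ w, ψ w * ((k.factorial : ℝ)⁻¹ • iteratedFDeriv ℝ k h 0 (fun _ => w)) = 0 := by
    intro k hk
    have := Finset.mem_range.1 hk
    exact integral_diag_zero hψ hm k (by omega) ((k.factorial : ℝ)⁻¹ • iteratedFDeriv ℝ k h 0)
  have hPi : Integrable (fun w => ψ w * P w) := by
    simp only [hP, Finset.mul_sum]
    exact integrable_finsetSum _ fun k h => (hk k h).1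
  have hP0 : ∫ w, ψ w * P w = 0 := by
    simp only [hP, Finset.mul_sum]
    rw [integral_finsetSum _ fun k h => (hk k h).1]
    exact Finset.sum_eq_zero fun k h => (hk k h).2
  have hhi : Integrable (fun w => ψ w * h w) := by
    apply Continuous.integrable_of_hasCompactSupport
    · exact hψ.1.continuous.mul hh.continuous
    · exact hψ.2.mul_right
  have hψi : Integrable ψ := hψ.1.continuous.integrable_of_hasCompactSupport hψ.2
  have : ∫ w, ψ w * h w = ∫ w, ψ w * (h w - P w) := by
    simp_rw [mul_sub]
    rw [integral_sub hhi hPi, hP0, sub_zero]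
  rw [this, ← Real.norm_eq_abs, ← integral_mul_const]
  apply norm_integral_le_of_norm_le (hψi.abs.mul_const _)
  refine Eventually.of_forall fun w => ?_
  rw [norm_mul, Real.norm_eq_abs, Real.norm_eq_abs]
  by_cases hw : ‖w‖ ≤ R
  · gcongr
    exact taylor_bound M hh hB w hw
  · rw [hR w (not_le.1 hw)]; simp

/-- Dilated kernel. -/
def scK (n k : ℕ) (Φ : (Fin n → ℝ) → ℝ) (x : Fin n → ℝ) : ℝ :=
  (2 : ℝ) ^ (k * n) * Φ ((2 : ℝ) ^ k • x)

lemma phiFam_zero (n : ℕ) (φ₀ : (Fin n → ℝ) → ℝ) : phiFam n φ₀ 0 = scK n 0 φ₀ := by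
  funext x; simp [phiFam, scK]

lemma phiFam_pos (n : ℕ) (φ₀ : (Fin n → ℝ) → ℝ) {k : ℕ} (hk : k ≠ 0) :
    phiFam n φ₀ k = scK n k (phiOf n φ₀) := by
  obtain ⟨k, rfl⟩ := Nat.exists_eq_succ_of_ne_zero hk
  funext x; simp [phiFam, scK]

lemma kernFam_zero (n : ℕ) (ψ₀ ψ : (Fin n → ℝ) → ℝ) : kernFam n ψ₀ ψ 0 = scK n 0 ψ₀ := by
  funext x; simp [kernFam, scK]

lemma kernFam_pos (n : ℕ) (ψ₀ ψ : (Fin n → ℝ) → ℝ) {k : ℕ} (hk : k ≠ 0) :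
    kernFam n ψ₀ ψ k = scK n k ψ := by
  obtain ⟨k, rfl⟩ := Nat.exists_eq_succ_of_ne_zero hk
  funext x; simp [kernFam, scK]

lemma scK_test {n k : ℕ} {Φ : (Fin n → ℝ) → ℝ} (h : IsTestFun n Φ) : IsTestFun n (scK n k Φ) := by
  constructor
  · unfold scK
    have := h.1
    fun_prop
  · unfold scK
    exact (h.2.comp_smul (c := (2 : ℝ) ^ k) (by positivity)).mul_left

lemma phiOf_test {n : ℕ} {φ₀ : (Fin n → ℝ) → ℝ} (h : IsTestFun n φ₀) : IsTestFun n (phiOf n φ₀) := by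
  constructor
  · unfold phiOf
    have := h.1
    fun_prop
  · unfold phiOf
    exact h.2.sub (h.2.comp_smul (c := (2 : ℝ)⁻¹) (by positivity)).mul_left

lemma kernFam_test {n : ℕ} {ψ₀ ψ : (Fin n → ℝ) → ℝ} (h₀ : IsTestFun n ψ₀) (h : IsTestFun n ψ) (j : ℕ) :
    IsTestFun n (kernFam n ψ₀ ψ j) := by
  by_cases hj : j = 0
  · subst hj; rw [kernFam_zero]; exact scK_test h₀
  · rw [kernFam_pos n ψ₀ ψ hj]; exact scK_test h

lemma phiFam_test {n : ℕ} {φ₀ : (Fin n → ℝ) → ℝ} (h₀ : IsTestFun n φ₀) (j : ℕ) :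
    IsTestFun n (phiFam n φ₀ j) := by
  by_cases hj : j = 0
  · subst hj; rw [phiFam_zero]; exact scK_test h₀
  · rw [phiFam_pos n φ₀ hj]; exact scK_test (phiOf_test h₀)

lemma test_radius {n : ℕ} {φ : (Fin n → ℝ) → ℝ} (h : IsTestFun n φ) :
    ∃ c : ℕ, ∀ w, (c : ℝ) < ‖w‖ → φ w = 0 := by
  obtain ⟨R, hR⟩ := h.2.isCompact.isBounded.subset_closedBall 0
  obtain ⟨c, hc⟩ := exists_nat_ge R
  refine ⟨c, fun w hw => image_eq_zero_of_notMem_tsupport fun hmem => ?_⟩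
  have := hR hmem
  simp at this
  linarith

lemma scK_cov_left (n j : ℕ) (ψ h : (Fin n → ℝ) → ℝ) (y : Fin n → ℝ) :
    ∫ z, scK n j ψ (z - y) * h z = ∫ w, ψ w * h (y + ((2 : ℝ) ^ j)⁻¹ • w) := by
  have h1 : ∫ z, scK n j ψ (z - y) * h z = ∫ z, scK n j ψ z * h (y + z) := by
    rw [← integral_add_right_eq_self (fun z => scK n j ψ (z - y) * h z) y]
    simp [add_comm]
  rw [h1]
  have h2 := Measure.integral_comp_smul_of_nonneg (volume : Measure (Fin n → ℝ))
    (fun w => ψ w * h (y + ((2 : ℝ) ^ j)⁻¹ • w)) ((2 : ℝ) ^ j) (hR := by positivity)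
  simp only [Module.finrank_fin_fun] at h2
  have h3 : ∀ z : Fin n → ℝ, ((2 : ℝ) ^ j)⁻¹ • ((2 : ℝ) ^ j) • z = z := fun z =>
    inv_smul_smul₀ (by positivity) z
  simp only [h3] at h2
  simp only [scK, mul_assoc]
  rw [integral_const_mul, h2, smul_eq_mul, ← mul_assoc, ← pow_mul, mul_inv_cancel₀ (by positivity),
    one_mul]

lemma scK_cov_right (n k : ℕ) (Φ h : (Fin n → ℝ) → ℝ) (x : Fin n → ℝ) :
    ∫ z, h z * scK n k Φ (x - z) = ∫ w, Φ w * h (x - ((2 : ℝ) ^ k)⁻¹ • w) := by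
  have h1 : ∫ z, h z * scK n k Φ (x - z) = ∫ z, scK n k Φ (z - 0) * h (x - z) := by
    rw [← integral_sub_left_eq_self (fun z => h z * scK n k Φ (x - z)) _ x]
    simp [mul_comm]
  rw [h1, scK_cov_left]
  simp

lemma iterated_bound {n : ℕ} {Φ : (Fin n → ℝ) → ℝ} (hΦ : IsTestFun n Φ) (M : ℕ) :
    ∃ B : ℝ, 0 ≤ B ∧ ∀ x, ‖iteratedFDeriv ℝ M Φ x‖ ≤ B := by
  have hc : Continuous (iteratedFDeriv ℝ M Φ) := hΦ.1.continuous_iteratedFDeriv (by exact_mod_cast le_top)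
  obtain ⟨B, hB⟩ := (hΦ.2.iteratedFDeriv M).exists_bound_of_continuous hc
  exact ⟨B, (norm_nonneg _).trans (hB 0), hB⟩

lemma iterated_affine {n : ℕ} {Φ : (Fin n → ℝ) → ℝ} (hΦ : ContDiff ℝ (⊤ : ℕ∞) Φ) (M : ℕ)
    (a : Fin n → ℝ) (r : ℝ) (w : Fin n → ℝ) :
    ‖iteratedFDeriv ℝ M (fun w => Φ (a + r • w)) w‖ = |r| ^ M * ‖iteratedFDeriv ℝ M Φ (a + r • w)‖ := by
  have h1 : ContDiff ℝ (M : ℕ∞) (fun z => Φ (a + z)) := by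
    have := hΦ.of_le (m := (M : ℕ∞)) (by exact_mod_cast le_top)
    fun_prop
  have h2 := iteratedFDeriv_comp_const_smul (𝕜 := ℝ) (i := M) (f := fun z => Φ (a + z)) r (by exact_mod_cast h1)
  rw [h2]
  simp only [norm_smul, norm_pow, Real.norm_eq_abs]
  rw [iteratedFDeriv_comp_add_left]

lemma kernel_gen {n : ℕ} {L : ℤ} {ψ Φ : (Fin n → ℝ) → ℝ} (hψ : IsTestFun n ψ) (hΦ : IsTestFun n Φ)
    (hm : MomentsVanish n L ψ) (M : ℕ) (hM : (M : ℤ) ≤ L + 1) :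
    ∃ C : ℝ, 0 ≤ C ∧ ∀ (a : Fin n → ℝ) (r : ℝ), 0 ≤ r →
      |∫ w, ψ w * Φ (a - r • w)| ≤ C * r ^ M := by
  obtain ⟨c, hc⟩ := test_radius hψ
  obtain ⟨B, hB0, hB⟩ := iterated_bound hΦ M
  refine ⟨(∫ w, |ψ w|) * (B * (c : ℝ) ^ M), by positivity, fun a r hr => ?_⟩
  have h1 := moment_bound hψ hm M hM hc (h := fun w => Φ (a + (-r) • w))
    (by have := hΦ.1; fun_prop) (B := r ^ M * B) (by
      intro w _
      rw [iterated_affine hΦ.1, abs_neg, abs_of_nonneg hr]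
      gcongr
      exact hB _)
  simp only [neg_smul, ← sub_eq_add_neg] at h1
  calc _ ≤ _ := h1
    _ = _ := by ring

lemma kernel_supp {n : ℕ} {ψ Φ : (Fin n → ℝ) → ℝ} {c : ℝ} (hψ : ∀ w, c < ‖w‖ → ψ w = 0)
    (hΦ : ∀ w, c < ‖w‖ → Φ w = 0) (a : Fin n → ℝ) (r : ℝ) (hr : 0 ≤ r) (hr1 : r ≤ 1)
    (ha : 2 * c < ‖a‖) : ∫ w, ψ w * Φ (a - r • w) = 0 := by
  have : ∀ w, ψ w * Φ (a - r • w) = 0 := by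
    intro w
    by_cases hw : c < ‖w‖
    · rw [hψ w hw, zero_mul]
    · rw [hΦ, mul_zero]
      have h1 := norm_sub_norm_le a (r • w)
      rw [norm_smul, Real.norm_eq_abs, abs_of_nonneg hr] at h1
      nlinarith [norm_nonneg w, not_lt.1 hw]
  simp [this]

lemma kernel_eq₁ (n j k : ℕ) (ψ Φ : (Fin n → ℝ) → ℝ) (x y : Fin n → ℝ) :
    ∫ z, scK n j ψ (z - y) * scK n k Φ (x - z) =
      2 ^ (k * n) * ∫ w, ψ w * Φ ((2 : ℝ) ^ k • (x - y) - ((2 : ℝ) ^ k / 2 ^ j) • w) := by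
  rw [scK_cov_left n j ψ (fun z => scK n k Φ (x - z)) y, ← integral_const_mul]
  refine integral_congr_ae (Eventually.of_forall fun w => ?_)
  simp only [scK]
  have : (2 : ℝ) ^ k • (x - (y + ((2 : ℝ) ^ j)⁻¹ • w)) = (2 : ℝ) ^ k • (x - y) - ((2 : ℝ) ^ k / 2 ^ j) • w := by
    rw [← sub_sub, smul_sub, smul_smul, div_eq_mul_inv]
  rw [this]; ring

lemma kernel_eq₂ (n j k : ℕ) (ψ Φ : (Fin n → ℝ) → ℝ) (x y : Fin n → ℝ) :
    ∫ z, scK n j ψ (z - y) * scK n k Φ (x - z) =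
      2 ^ (j * n) * ∫ w, Φ w * ψ ((2 : ℝ) ^ j • (x - y) - ((2 : ℝ) ^ j / 2 ^ k) • w) := by
  rw [scK_cov_right n k Φ (fun z => scK n j ψ (z - y)) x, ← integral_const_mul]
  refine integral_congr_ae (Eventually.of_forall fun w => ?_)
  simp only [scK]
  have : (2 : ℝ) ^ j • (x - ((2 : ℝ) ^ k)⁻¹ • w - y) = (2 : ℝ) ^ j • (x - y) - ((2 : ℝ) ^ j / 2 ^ k) • w := by
    rw [sub_right_comm, smul_sub, smul_smul, div_eq_mul_inv]
  rw [this]; ring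

lemma moments_neg (n : ℕ) (ψ : (Fin n → ℝ) → ℝ) : MomentsVanish n (-1) ψ := by
  intro β hβ
  exfalso
  have : (0 : ℤ) ≤ ((∑ i, β i : ℕ) : ℤ) := Int.natCast_nonneg _
  omega

/-- Bounds and supports of `φ_k * ψ_j`. -/
lemma kernel_bound {n : ℕ} {φ₀ ψ₀ ψ : (Fin n → ℝ) → ℝ} (hφ₀ : IsTestFun n φ₀) (hψ₀ : IsTestFun n ψ₀)
    (hψ : IsTestFun n ψ) {Lφ Lψ : ℤ} (hmφ : MomentsVanish n Lφ (phiOf n φ₀))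
    (hmψ : MomentsVanish n Lψ ψ) (M' M : ℕ) (hM' : (M' : ℤ) ≤ Lφ + 1) (hM : (M : ℤ) ≤ Lψ + 1) :
    ∃ (C : ℝ) (c : ℕ), 0 < C ∧ ∀ (j k : ℕ) (x y : Fin n → ℝ),
      (k ≤ j → |∫ z, kernFam n ψ₀ ψ j (z - y) * phiFam n φ₀ k (x - z)| ≤
        C * 2 ^ (k * n) * ((2 : ℝ) ^ k / 2 ^ j) ^ M ∧
        ((c : ℝ) < 2 ^ k * ‖x - y‖ → ∫ z, kernFam n ψ₀ ψ j (z - y) * phiFam n φ₀ k (x - z) = 0)) ∧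
      (j < k → |∫ z, kernFam n ψ₀ ψ j (z - y) * phiFam n φ₀ k (x - z)| ≤
        C * 2 ^ (j * n) * ((2 : ℝ) ^ j / 2 ^ k) ^ M' ∧
        ((c : ℝ) < 2 ^ j * ‖x - y‖ → ∫ z, kernFam n ψ₀ ψ j (z - y) * phiFam n φ₀ k (x - z) = 0)) := by
  have hφ := phiOf_test hφ₀
  obtain ⟨C1, h1, H1⟩ := kernel_gen hψ₀ hφ₀ (moments_neg n ψ₀) 0 (by simp)
  obtain ⟨C2, h2, H2⟩ := kernel_gen hψ hφ₀ hmψ M hM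
  obtain ⟨C3, h3, H3⟩ := kernel_gen hψ hφ hmψ M hM
  obtain ⟨C4, h4, H4⟩ := kernel_gen hφ hψ₀ hmφ M' hM'
  obtain ⟨C5, h5, H5⟩ := kernel_gen hφ hψ hmφ M' hM'
  obtain ⟨c1, k1⟩ := test_radius hφ₀
  obtain ⟨c2, k2⟩ := test_radius hφ
  obtain ⟨c3, k3⟩ := test_radius hψ₀
  obtain ⟨c4, k4⟩ := test_radius hψ
  set c := c1 + c2 + c3 + c4 with hc
  have e1 : (c1 : ℝ) ≤ c := by rw [hc]; exact_mod_cast (by omega)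
  have e2 : (c2 : ℝ) ≤ c := by rw [hc]; exact_mod_cast (by omega)
  have e3 : (c3 : ℝ) ≤ c := by rw [hc]; exact_mod_cast (by omega)
  have e4 : (c4 : ℝ) ≤ c := by rw [hc]; exact_mod_cast (by omega)
  replace k1 : ∀ w, (c : ℝ) < ‖w‖ → φ₀ w = 0 := fun w hw => k1 w (e1.trans_lt hw)
  replace k2 : ∀ w, (c : ℝ) < ‖w‖ → phiOf n φ₀ w = 0 := fun w hw => k2 w (e2.trans_lt hw)
  replace k3 : ∀ w, (c : ℝ) < ‖w‖ → ψ₀ w = 0 := fun w hw => k3 w (e3.trans_lt hw)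
  replace k4 : ∀ w, (c : ℝ) < ‖w‖ → ψ w = 0 := fun w hw => k4 w (e4.trans_lt hw)
  refine ⟨C1 + C2 + C3 + C4 + C5 + 1, 2 * c, by positivity, fun j k x y => ⟨fun hkj => ?_, fun hjk => ?_⟩⟩
  · have hr0 : (0 : ℝ) ≤ 2 ^ k / 2 ^ j := by positivity
    have hr1 : (2 : ℝ) ^ k / 2 ^ j ≤ 1 := by
      rw [div_le_one (by positivity)]; exact pow_le_pow_right₀ (by norm_num) hkj
    have key : ∀ (ψ' Φ : (Fin n → ℝ) → ℝ) (C' : ℝ), kernFam n ψ₀ ψ j = scK n j ψ' →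
        phiFam n φ₀ k = scK n k Φ → (∀ w, (c : ℝ) < ‖w‖ → ψ' w = 0) → (∀ w, (c : ℝ) < ‖w‖ → Φ w = 0) →
        (∀ a : Fin n → ℝ, |∫ w, ψ' w * Φ (a - ((2 : ℝ) ^ k / 2 ^ j) • w)| ≤ C' * ((2 : ℝ) ^ k / 2 ^ j) ^ M) →
        C' ≤ C1 + C2 + C3 + C4 + C5 + 1 →
        |∫ z, kernFam n ψ₀ ψ j (z - y) * phiFam n φ₀ k (x - z)| ≤
        (C1 + C2 + C3 + C4 + C5 + 1) * 2 ^ (k * n) * ((2 : ℝ) ^ k / 2 ^ j) ^ M ∧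
        (((2 * c : ℕ) : ℝ) < 2 ^ k * ‖x - y‖ → ∫ z, kernFam n ψ₀ ψ j (z - y) * phiFam n φ₀ k (x - z) = 0) := by
      intro ψ' Φ C' a1 a2 a3 a4 a5 a6
      rw [a1, a2, kernel_eq₁]
      constructor
      · rw [abs_mul, abs_of_pos (by positivity : (0 : ℝ) < 2 ^ (k * n))]
        calc _ ≤ 2 ^ (k * n) * (C' * ((2 : ℝ) ^ k / 2 ^ j) ^ M) := by gcongr; exact a5 _
          _ ≤ 2 ^ (k * n) * ((C1 + C2 + C3 + C4 + C5 + 1) * ((2 : ℝ) ^ k / 2 ^ j) ^ M) := by gcongr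
          _ = _ := by ring
      · intro hx
        rw [kernel_supp a3 a4 _ _ hr0 hr1, mul_zero]
        rw [norm_smul, norm_pow, Real.norm_ofNat]
        push_cast at hx
        exact hx
    by_cases hj : j = 0
    · have hk : k = 0 := by omega
      subst hj; subst hk
      exact key ψ₀ φ₀ C1 (kernFam_zero _ _ _) (phiFam_zero _ _) k3 k1 (fun a => by
        have := H1 a 1 (by norm_num)
        simpa using this) (by linarith)
    · by_cases hk : k = 0
      · subst hk
        exact key ψ φ₀ C2 (kernFam_pos _ _ _ hj) (phiFam_zero _ _) k4 k1 (fun a => H2 a _ hr0) (by linarith)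
      · exact key ψ (phiOf n φ₀) C3 (kernFam_pos _ _ _ hj) (phiFam_pos _ _ hk) k4 k2 (fun a => H3 a _ hr0) (by linarith)
  · have hr0 : (0 : ℝ) ≤ 2 ^ j / 2 ^ k := by positivity
    have hr1 : (2 : ℝ) ^ j / 2 ^ k ≤ 1 := by
      rw [div_le_one (by positivity)]; exact pow_le_pow_right₀ (by norm_num) hjk.le
    have key : ∀ (ψ' Φ : (Fin n → ℝ) → ℝ) (C' : ℝ), kernFam n ψ₀ ψ j = scK n j ψ' →
        phiFam n φ₀ k = scK n k Φ → (∀ w, (c : ℝ) < ‖w‖ → ψ' w = 0) → (∀ w, (c : ℝ) < ‖w‖ → Φ w = 0) →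
        (∀ a : Fin n → ℝ, |∫ w, Φ w * ψ' (a - ((2 : ℝ) ^ j / 2 ^ k) • w)| ≤ C' * ((2 : ℝ) ^ j / 2 ^ k) ^ M') →
        C' ≤ C1 + C2 + C3 + C4 + C5 + 1 →
        |∫ z, kernFam n ψ₀ ψ j (z - y) * phiFam n φ₀ k (x - z)| ≤
        (C1 + C2 + C3 + C4 + C5 + 1) * 2 ^ (j * n) * ((2 : ℝ) ^ j / 2 ^ k) ^ M' ∧
        (((2 * c : ℕ) : ℝ) < 2 ^ j * ‖x - y‖ → ∫ z, kernFam n ψ₀ ψ j (z - y) * phiFam n φ₀ k (x - z) = 0) := by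
      intro ψ' Φ C' a1 a2 a3 a4 a5 a6
      rw [a1, a2, kernel_eq₂]
      constructor
      · rw [abs_mul, abs_of_pos (by positivity : (0 : ℝ) < 2 ^ (j * n))]
        calc _ ≤ 2 ^ (j * n) * (C' * ((2 : ℝ) ^ j / 2 ^ k) ^ M') := by gcongr; exact a5 _
          _ ≤ 2 ^ (j * n) * ((C1 + C2 + C3 + C4 + C5 + 1) * ((2 : ℝ) ^ j / 2 ^ k) ^ M') := by gcongr
          _ = _ := by ring
      · intro hx
        rw [kernel_supp a4 a3 _ _ hr0 hr1, mul_zero]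
        rw [norm_smul, norm_pow, Real.norm_ofNat]
        push_cast at hx
        exact hx
    have hk : k ≠ 0 := by omega
    by_cases hj : j = 0
    · subst hj
      exact key ψ₀ (phiOf n φ₀) C4 (kernFam_zero _ _ _) (phiFam_pos _ _ hk) k3 k2 (fun a => H4 a _ hr0) (by linarith)
    · exact key ψ (phiOf n φ₀) C5 (kernFam_pos _ _ _ hj) (phiFam_pos _ _ hk) k4 k2 (fun a => H5 a _ hr0) (by linarith)

lemma se_decay {n : ℕ} {N : ℕ} {θ : (Fin n → ℝ) → ℝ} (h : seSeminorm n N θ ≠ ∞) :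
    ∃ P : ℝ, 0 ≤ P ∧ ∀ x, ∀ i ≤ N, ‖iteratedFDeriv ℝ i θ x‖ ≤ P * Real.exp (-(N * ‖x‖)) := by
  refine ⟨(seSeminorm n N θ).toReal, ENNReal.toReal_nonneg, fun x i hi => ?_⟩
  have h1 : ENNReal.ofReal (Real.exp (N * ‖x‖) * ∑ i ∈ Finset.range (N + 1), ‖iteratedFDeriv ℝ i θ x‖)
      ≤ seSeminorm n N θ :=
    le_iSup (fun x : Fin n → ℝ => ENNReal.ofReal
      (Real.exp (N * ‖x‖) * ∑ i ∈ Finset.range (N + 1), ‖iteratedFDeriv ℝ i θ x‖)) x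
  have h2 := (ENNReal.ofReal_le_iff_le_toReal h).1 h1
  have h3 : ‖iteratedFDeriv ℝ i θ x‖ ≤ ∑ i ∈ Finset.range (N + 1), ‖iteratedFDeriv ℝ i θ x‖ :=
    Finset.single_le_sum (f := fun i => ‖iteratedFDeriv ℝ i θ x‖) (fun _ _ => norm_nonneg _)
      (Finset.mem_range.2 (by omega))
  rw [Real.exp_neg, ← div_eq_mul_inv, le_div_iff₀ (Real.exp_pos _)]
  calc _ ≤ _ := mul_le_mul_of_nonneg_right h3 (Real.exp_pos _).le
    _ = _ := mul_comm _ _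
    _ ≤ _ := h2

lemma test_se {n : ℕ} {θ : (Fin n → ℝ) → ℝ} (h : IsTestFun n θ) (N : ℕ) : seSeminorm n N θ ≠ ∞ := by
  have hc : ∀ i, Continuous (fun x => ‖iteratedFDeriv ℝ i θ x‖) := fun i =>
    (h.1.continuous_iteratedFDeriv (by exact_mod_cast le_top)).norm
  have hcont : Continuous (fun x : Fin n → ℝ =>
      (∑ i ∈ Finset.range (N + 1), ‖iteratedFDeriv ℝ i θ x‖) * Real.exp (N * ‖x‖)) := by
    apply Continuous.mul _ (by fun_prop)
    exact continuous_finsetSum _ fun i _ => hc i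
  have hs : HasCompactSupport (fun x : Fin n → ℝ =>
      (∑ i ∈ Finset.range (N + 1), ‖iteratedFDeriv ℝ i θ x‖) * Real.exp (N * ‖x‖)) := by
    apply HasCompactSupport.mul_right
    refine HasCompactSupport.intro h.2 fun x hx => ?_
    refine Finset.sum_eq_zero fun i _ => ?_
    rw [norm_eq_zero]
    by_contra hne
    exact hx (support_iteratedFDeriv_subset (𝕜 := ℝ) i hne)
  obtain ⟨B, hB⟩ := hs.exists_bound_of_continuous hcont
  have : seSeminorm n N θ ≤ ENNReal.ofReal B := by
    refine iSup_le fun x => ENNReal.ofReal_le_ofReal ?_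
    rw [mul_comm]
    exact (Real.le_norm_self _).trans (hB x)
  exact ne_top_of_le_ne_top ENNReal.ofReal_ne_top this

lemma exp_integrable (n : ℕ) : Integrable (fun y : Fin n → ℝ => Real.exp (-((n + 1 : ℝ) * ‖y‖))) := by
  have h := integrable_one_add_norm (E := Fin n → ℝ) (μ := volume) (r := n + 1) (by simp)
  refine h.mono' (by fun_prop) (Eventually.of_forall fun y => ?_)
  rw [Real.norm_eq_abs, abs_of_pos (Real.exp_pos _)]
  have h1 : 1 + ‖y‖ ≤ Real.exp ‖y‖ := by rw [add_comm]; exact Real.add_one_le_exp _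
  have h2 : (0 : ℝ) < 1 + ‖y‖ := by positivity
  calc Real.exp (-((n + 1 : ℝ) * ‖y‖)) = Real.exp ‖y‖ ^ (-(n + 1 : ℝ)) := by
        rw [← Real.exp_mul]; congr 1; ring
    _ ≤ _ := Real.rpow_le_rpow_of_nonpos h2 h1 (by linarith [(Nat.cast_nonneg n : (0 : ℝ) ≤ n)])

lemma exp_split {n l : ℕ} (y : Fin n → ℝ) :
    Real.exp (l * ‖y‖) * Real.exp (-((l + n + 1 : ℕ) * ‖y‖)) = Real.exp (-((n + 1 : ℝ) * ‖y‖)) := by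
  rw [← Real.exp_add]; congr 1; push_cast; ring

lemma fubini_se {n l : ℕ} {κ θ g : (Fin n → ℝ) → ℝ} (hκ : IsTestFun n κ) (hθ : Continuous θ)
    (hg : Measurable g) {B P : ℝ} (hgB : ∀ y, |g y| ≤ B * Real.exp (l * ‖y‖))
    (hθP : ∀ x, |θ x| ≤ P * Real.exp (-((l + n + 1 : ℕ) * ‖x‖))) :
    Integrable (fun x => (∫ y, κ (x - y) * g y) * θ x) ∧
    ∫ x, (∫ y, κ (x - y) * g y) * θ x = ∫ y, g y * ∫ x, κ (x - y) * θ x := by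
  set N := l + n + 1 with hN
  have hP : 0 ≤ P := by
    have := (abs_nonneg _).trans (hθP 0)
    simpa using this
  have hB : 0 ≤ B := by
    have := (abs_nonneg _).trans (hgB 0)
    simpa using this
  have hκc := hκ.1.continuous
  have i1 : Integrable (fun y : Fin n → ℝ => B * P * Real.exp (-((n + 1 : ℝ) * ‖y‖))) :=
    (exp_integrable n).const_mul _
  have i2 : Integrable (fun y : Fin n → ℝ => |κ y| * Real.exp (N * ‖y‖)) := by
    apply Continuous.integrable_of_hasCompactSupport (by fun_prop)
    exact (hκ.2.comp_left (g := fun t : ℝ => |t|) abs_zero).mul_right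
  have i3 := i1.convolution_integrand (ContinuousLinearMap.mul ℝ ℝ) i2
  have i4 : Integrable (fun p : (Fin n → ℝ) × (Fin n → ℝ) => κ (p.1 - p.2) * g p.2 * θ p.1)
      (volume.prod volume) := by
    refine i3.mono' ?_ (Eventually.of_forall fun p => ?_)
    · apply Measurable.aestronglyMeasurable
      have := hκc.measurable
      have := hθ.measurable
      fun_prop
    · obtain ⟨x, y⟩ := p
      simp only [norm_mul, Real.norm_eq_abs, ContinuousLinearMap.mul_apply']
      have e1 : Real.exp (-(N * ‖x‖)) ≤ Real.exp (N * ‖x - y‖) * Real.exp (-(N * ‖y‖)) := by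
        rw [← Real.exp_add]
        apply Real.exp_le_exp.2
        have : ‖y‖ ≤ ‖x‖ + ‖x - y‖ := by
          have := norm_sub_le x (x - y); simpa using this
        nlinarith [(Nat.cast_nonneg N : (0 : ℝ) ≤ N)]
      calc |κ (x - y)| * |g y| * |θ x| ≤ |κ (x - y)| * (B * Real.exp (l * ‖y‖)) *
            (P * (Real.exp (N * ‖x - y‖) * Real.exp (-(N * ‖y‖)))) := by
            gcongr
            · exact hgB y
            · exact (hθP x).trans (by gcongr)
        _ = B * P * (Real.exp (l * ‖y‖) * Real.exp (-(N * ‖y‖))) * (|κ (x - y)| * Real.exp (N * ‖x - y‖)) := by ring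
        _ = _ := by rw [hN, exp_split]
  have e : ∀ x, (∫ y, κ (x - y) * g y) * θ x = ∫ y, κ (x - y) * g y * θ x := fun x => by
    rw [integral_mul_const]
  simp_rw [e]
  constructor
  · exact i4.integral_prod_left
  · rw [integral_integral_swap i4]
    refine integral_congr_ae (Eventually.of_forall fun y => ?_)
    simp only
    rw [← integral_const_mul]
    refine integral_congr_ae (Eventually.of_forall fun x => ?_)
    simp only; ring

lemma J_decay {n : ℕ} {L : ℤ} {ψ₀ ψ θ : (Fin n → ℝ) → ℝ} (hψ : IsTestFun n ψ)
    (hm : MomentsVanish n L ψ) (M : ℕ) (hM : (M : ℤ) ≤ L + 1) (hθ : ContDiff ℝ (⊤ : ℕ∞) θ)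
    (N : ℕ) {P : ℝ} (hP : 0 ≤ P) (hθP : ∀ x, ‖iteratedFDeriv ℝ M θ x‖ ≤ P * Real.exp (-(N * ‖x‖))) :
    ∃ C : ℝ, 0 ≤ C ∧ ∀ j ≠ 0, ∀ y, |∫ x, kernFam n ψ₀ ψ j (x - y) * θ x| ≤
      C * (((2 : ℝ) ^ j)⁻¹) ^ M * Real.exp (-(N * ‖y‖)) := by
  obtain ⟨c, hc⟩ := test_radius hψ
  refine ⟨(∫ w, |ψ w|) * (P * Real.exp (N * c) * (c : ℝ) ^ M), by positivity, fun j hj y => ?_⟩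
  rw [kernFam_pos _ _ _ hj, scK_cov_left]
  have h1 := moment_bound hψ hm M hM hc (h := fun w => θ (y + ((2 : ℝ) ^ j)⁻¹ • w))
    (by fun_prop) (B := (((2 : ℝ) ^ j)⁻¹) ^ M * (P * (Real.exp (N * c) * Real.exp (-(N * ‖y‖))))) (by
      intro w hw
      rw [iterated_affine hθ, abs_of_pos (by positivity)]
      gcongr
      refine (hθP _).trans ?_
      gcongr
      rw [← Real.exp_add]
      apply Real.exp_le_exp.2
      have e1 : ‖y‖ ≤ ‖y + ((2 : ℝ) ^ j)⁻¹ • w‖ + ‖((2 : ℝ) ^ j)⁻¹ • w‖ := by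
        have := norm_sub_le (y + ((2 : ℝ) ^ j)⁻¹ • w) (((2 : ℝ) ^ j)⁻¹ • w); simpa using this
      have e2 : ‖((2 : ℝ) ^ j)⁻¹ • w‖ ≤ c := by
        rw [norm_smul, norm_inv, norm_pow, Real.norm_ofNat]
        have : ((2 : ℝ) ^ j)⁻¹ ≤ 1 := inv_le_one_of_one_le₀ (one_le_pow₀ (by norm_num))
        nlinarith [norm_nonneg w]
      nlinarith [(Nat.cast_nonneg N : (0 : ℝ) ≤ N)])
  calc _ ≤ _ := h1
    _ = _ := by ring

/-- Construction of the distribution. -/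
lemma series_exists {n l : ℕ} {L : ℤ} {ψ₀ ψ : (Fin n → ℝ) → ℝ} (hψ₀ : IsTestFun n ψ₀) (hψ : IsTestFun n ψ)
    (hm : MomentsVanish n L ψ) (M : ℕ) (hM : (M : ℤ) ≤ L + 1) {A B : ℝ} (hAM : A < M)
    {g : ℕ → (Fin n → ℝ) → ℝ} (hg : ∀ j, Measurable (g j))
    (hgB : ∀ j y, |g j y| ≤ B * (2 : ℝ) ^ (A * j) * Real.exp (l * ‖y‖)) :
    ∃ F : Dstrb n, ∀ θ : (Fin n → ℝ) → ℝ, ContDiff ℝ (⊤ : ℕ∞) θ →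
          (∀ N : ℕ, seSeminorm n N θ ≠ ∞) →
          Filter.Tendsto
            (fun K : ℕ => ∑ j ∈ Finset.range K,
              ∫ x, (∫ y, kernFam n ψ₀ ψ j (x - y) * g j y) * θ x)
            Filter.atTop (nhds (F θ)) ∧
          F θ = ∑' j, ∫ y, g j y * ∫ x, kernFam n ψ₀ ψ j (x - y) * θ x := by
  set S : ℕ → ((Fin n → ℝ) → ℝ) → ℝ := fun j θ =>
    ∫ x, (∫ y, kernFam n ψ₀ ψ j (x - y) * g j y) * θ x with hS
  let V : Submodule ℝ ((Fin n → ℝ) → ℝ) :=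
    { carrier := {θ | (∀ j, Integrable fun x => (∫ y, kernFam n ψ₀ ψ j (x - y) * g j y) * θ x) ∧
        Summable fun j => S j θ}
      zero_mem' := by simp [hS, summable_zero]
      add_mem' := by
        rintro a b ⟨ha1, ha2⟩ ⟨hb1, hb2⟩
        refine ⟨fun j => ?_, ?_⟩
        · simp only [Pi.add_apply, mul_add]; exact (ha1 j).add (hb1 j)
        · have : ∀ j, S j (a + b) = S j a + S j b := fun j => by
            simp only [hS, Pi.add_apply, mul_add]; exact integral_add (ha1 j) (hb1 j)
          simp_rw [this]; exact ha2.add hb2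
      smul_mem' := by
        rintro r a ⟨ha1, ha2⟩
        refine ⟨fun j => ?_, ?_⟩
        · simp only [Pi.smul_apply, smul_eq_mul, mul_left_comm _ r]; exact (ha1 j).const_mul _
        · have : ∀ j, S j (r • a) = r * S j a := fun j => by
            simp only [hS, Pi.smul_apply, smul_eq_mul, mul_left_comm _ r]; exact integral_const_mul _ _
          simp_rw [this]; exact ha2.mul_left _ }
  let F₀ : V →ₗ[ℝ] ℝ :=
    { toFun := fun θ => ∑' j, S j θ.1
      map_add' := by
        rintro ⟨a, ha1, ha2⟩ ⟨b, hb1, hb2⟩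
        have : ∀ j, S j (a + b) = S j a + S j b := fun j => by
            simp only [hS, Pi.add_apply, mul_add]; exact integral_add (ha1 j) (hb1 j)
        simp only [Submodule.coe_add, this]
        exact ha2.tsum_add hb2
      map_smul' := by
        rintro r ⟨a, ha1, ha2⟩
        have : ∀ j, S j (r • a) = r * S j a := fun j => by
            simp only [hS, Pi.smul_apply, smul_eq_mul, mul_left_comm _ r]; exact integral_const_mul _ _
        simp only [SetLike.val_smul, this, RingHom.id_apply, smul_eq_mul]
        exact tsum_mul_left }
  obtain ⟨F, hF⟩ := LinearMap.exists_extend F₀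
  refine ⟨F, fun θ hθ hse => ?_⟩
  have hB : 0 ≤ B := by
    have := (abs_nonneg _).trans (hgB 0 0)
    simpa using this
  obtain ⟨P, hP, hPθ⟩ := se_decay (hse (l + n + 1))
  have hθP : ∀ x, |θ x| ≤ P * Real.exp (-((l + n + 1 : ℕ) * ‖x‖)) := fun x => by
    simpa using hPθ x 0 (by omega)
  have hfub := fun j => fubini_se (kernFam_test hψ₀ hψ j) hθ.continuous (hg j) (hgB j) hθP
  have hsum : Summable fun j => S j θ := by
    rw [← summable_nat_add_iff 1]
    obtain ⟨P', hP', hPθ'⟩ := se_decay (hse (l + n + 1 + M))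
    have hd : ∀ x, ‖iteratedFDeriv ℝ M θ x‖ ≤ P' * Real.exp (-((l + n + 1 : ℕ) * ‖x‖)) := fun x => by
      refine (hPθ' x M (by omega)).trans ?_
      have e0 : ((l + n + 1 : ℕ) : ℝ) ≤ ((l + n + 1 + M : ℕ) : ℝ) := Nat.cast_le.2 (Nat.le_add_right _ _)
      have e1 := mul_le_mul_of_nonneg_right e0 (norm_nonneg x)
      exact mul_le_mul_of_nonneg_left (Real.exp_le_exp.2 (neg_le_neg e1)) hP'
    obtain ⟨C, hC, hCb⟩ := J_decay (ψ₀ := ψ₀) hψ hm M hM hθ (l + n + 1) hP' hd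
    set I := ∫ y : Fin n → ℝ, Real.exp (-((n + 1 : ℝ) * ‖y‖)) with hI
    have hb : ∀ j ≠ 0, ‖S j θ‖ ≤ (B * C * I) * ((2 : ℝ) ^ (A - M)) ^ j := by
      intro j hj
      simp only [hS]
      rw [(hfub j).2]
      have e : ∀ y, ‖g j y * ∫ x, kernFam n ψ₀ ψ j (x - y) * θ x‖ ≤
          (B * C * ((2 : ℝ) ^ (A - M)) ^ j) * Real.exp (-((n + 1 : ℝ) * ‖y‖)) := by
        intro y
        rw [norm_mul, Real.norm_eq_abs, Real.norm_eq_abs]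
        calc _ ≤ (B * (2 : ℝ) ^ (A * j) * Real.exp (l * ‖y‖)) *
              (C * (((2 : ℝ) ^ j)⁻¹) ^ M * Real.exp (-((l + n + 1 : ℕ) * ‖y‖))) := by
              gcongr
              · exact hgB j y
              · exact hCb j hj y
          _ = (B * C * ((2 : ℝ) ^ (A * j) * (((2 : ℝ) ^ j)⁻¹) ^ M)) *
              (Real.exp (l * ‖y‖) * Real.exp (-((l + n + 1 : ℕ) * ‖y‖))) := by ring
          _ = _ := by
              rw [exp_split]
              congr 2
              rw [← Real.rpow_natCast (2 ^ (A - M)), ← Real.rpow_mul (by norm_num), sub_mul,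
                Real.rpow_sub (by norm_num), div_eq_mul_inv]
              congr 1
              rw [inv_pow, ← pow_mul, mul_comm j M, ← Nat.cast_mul, Real.rpow_natCast]
      calc _ ≤ ∫ y, (B * C * ((2 : ℝ) ^ (A - M)) ^ j) * Real.exp (-((n + 1 : ℝ) * ‖y‖)) :=
            norm_integral_le_of_norm_le ((exp_integrable n).const_mul _) (Eventually.of_forall e)
        _ = _ := by rw [integral_const_mul]; ring
    have hr : (2 : ℝ) ^ (A - M) < 1 := Real.rpow_lt_one_of_one_lt_of_neg (by norm_num) (by linarith)
    have hgeo := (summable_geometric_of_lt_one (by positivity) hr).mul_left (B * C * I)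
    exact Summable.of_norm_bounded ((summable_nat_add_iff 1).2 hgeo) fun j => hb (j + 1) (by omega)
  have hV : θ ∈ V := ⟨fun j => (hfub j).1, hsum⟩
  have hFθ : F θ = ∑' j, S j θ := by
    have := LinearMap.congr_fun hF ⟨θ, hV⟩
    simpa [F₀] using this
  constructor
  · rw [hFθ]; exact hsum.hasSum.tendsto_sum_nat
  · rw [hFθ]
    exact tsum_congr fun j => (hfub j).2

lemma le_lpSum {ι : Type*} {p : ℝ≥0∞} (hp : 0 < p) (a : ι → ℝ≥0∞) (m : ι) : a m ≤ lpSum p a := by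
  unfold lpSum
  split_ifs with h
  · exact le_iSup a m
  · have hp' : 0 < p.toReal := ENNReal.toReal_pos hp.ne' h
    rw [one_div, ENNReal.le_rpow_inv_iff hp']
    exact ENNReal.le_tsum m

lemma iSup_finset_rpow_le {ι : Type*} (E : Finset ι) (f : ι → ℝ≥0∞) {p : ℝ} (hp : 0 < p) :
    (⨆ e ∈ E, f e) ^ p ≤ ∑ e ∈ E, f e ^ p := by
  rw [← ENNReal.le_rpow_inv_iff hp]
  refine iSup₂_le fun e he => ?_
  rw [ENNReal.le_rpow_inv_iff hp]
  exact Finset.single_le_sum (f := fun e => f e ^ p) (fun _ _ => zero_le) he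

lemma geom_sum_le (s : ℝ≥0∞) (k : ℕ) : ∑ i ∈ Finset.range k, s ^ i ≤ (1 - s)⁻¹ := by
  rw [← ENNReal.tsum_geometric]
  exact ENNReal.sum_le_tsum _

lemma sum_geom_le_sup (s : ℝ≥0∞) (k : ℕ) (u : ℕ → ℝ≥0∞) :
    ∑ i ∈ Finset.range k, (s * s) ^ i * u i ≤ (1 - s)⁻¹ * ⨆ i ∈ Finset.range k, s ^ i * u i := by
  calc _ ≤ ∑ i ∈ Finset.range k, s ^ i * ⨆ i ∈ Finset.range k, s ^ i * u i := by
        refine Finset.sum_le_sum fun i hi => ?_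
        rw [mul_pow, mul_assoc]
        gcongr
        exact le_iSup₂ (f := fun i (_ : i ∈ Finset.range k) => s ^ i * u i) i hi
    _ = (∑ i ∈ Finset.range k, s ^ i) * ⨆ i ∈ Finset.range k, s ^ i * u i := by rw [Finset.sum_mul]
    _ ≤ _ := by gcongr; exact geom_sum_le s k

lemma inv_one_sub_ne_top {s : ℝ≥0∞} (hs : s < 1) : (1 - s)⁻¹ ≠ ∞ := by
  rw [Ne, ENNReal.inv_eq_top]
  exact pos_iff_ne_zero.mp (tsub_pos_of_lt hs)

/-- Geometric sums in `L_p`, all `0 < p ≤ ∞`. -/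
lemma eLpNorm_geom {X : Type*} [MeasurableSpace X] (μ : Measure X) {p : ℝ≥0∞} (hp : 0 < p)
    {w : ℝ≥0∞} (hw : w < 1) :
    ∃ C : ℝ≥0∞, C ≠ ∞ ∧ ∀ (k : ℕ) (u : ℕ → X → ℝ≥0∞) (b : ℕ → ℝ≥0∞), (∀ i, Measurable (u i)) →
      (∀ i ∈ Finset.range k, eLpNorm (u i) p μ ≤ b i) →
      eLpNorm (fun x => ∑ i ∈ Finset.range k, ((w * w) * (w * w)) ^ i * u i x) p μ ≤
        C * ⨆ i ∈ Finset.range k, w ^ i * b i := by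
  have hs : w * w < 1 := by
    calc w * w ≤ w * 1 := by gcongr
      _ = w := mul_one w
      _ < 1 := hw
  by_cases hpt : p = ∞
  · subst hpt
    refine ⟨(1 - w)⁻¹, inv_one_sub_ne_top hw, fun k u b hu hb => ?_⟩
    rw [eLpNorm_exponent_top]
    apply eLpNormEssSup_le_of_ae_enorm_bound
    have : ∀ᵐ x ∂μ, ∀ i, u i x ≤ eLpNorm (u i) ∞ μ := by
      rw [ae_all_iff]; intro i
      rw [eLpNorm_exponent_top]
      exact enorm_ae_le_eLpNormEssSup (u i) μ
    filter_upwards [this] with x hx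
    rw [enorm_eq_self]
    refine le_trans ?_ (sum_geom_le_sup w k b)
    refine Finset.sum_le_sum fun i hi => ?_
    gcongr ?_ ^ i * ?_
    · calc w * w * (w * w) ≤ w * w * 1 := by gcongr
        _ = w * w := mul_one _
    · exact (hx i).trans (hb i hi)
  · have hp' : 0 < p.toReal := ENNReal.toReal_pos hp.ne' hpt
    have hwp : w ^ p.toReal < 1 := ENNReal.rpow_lt_one hw hp'
    refine ⟨(1 - w * w)⁻¹ * ((1 - w ^ p.toReal)⁻¹) ^ (1 / p.toReal),
      ENNReal.mul_ne_top (inv_one_sub_ne_top hs)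
        (ENNReal.rpow_ne_top_of_nonneg (by positivity) (inv_one_sub_ne_top hwp)), fun k u b hu hb => ?_⟩
    set T := ⨆ i ∈ Finset.range k, w ^ i * b i with hT
    rw [eLpNorm_eq_lintegral_rpow_enorm_toReal hp.ne' hpt]
    rw [one_div, ENNReal.rpow_inv_le_iff hp']
    calc _ ≤ ∫⁻ x, ((1 - w * w)⁻¹) ^ p.toReal * ∑ i ∈ Finset.range k, ((w * w) ^ i) ^ p.toReal * (u i x) ^ p.toReal ∂μ := by
          refine lintegral_mono fun x => ?_
          simp only [enorm_eq_self]
          calc _ ≤ ((1 - w * w)⁻¹ * ⨆ i ∈ Finset.range k, (w * w) ^ i * u i x) ^ p.toReal := by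
                gcongr
                exact sum_geom_le_sup (w * w) k (fun i => u i x)
            _ = ((1 - w * w)⁻¹) ^ p.toReal * (⨆ i ∈ Finset.range k, (w * w) ^ i * u i x) ^ p.toReal :=
                ENNReal.mul_rpow_of_nonneg _ _ hp'.le
            _ ≤ ((1 - w * w)⁻¹) ^ p.toReal * ∑ i ∈ Finset.range k, ((w * w) ^ i * u i x) ^ p.toReal := by
                gcongr
                exact iSup_finset_rpow_le _ _ hp'
            _ = _ := by simp_rw [ENNReal.mul_rpow_of_nonneg _ _ hp'.le]
      _ = ((1 - w * w)⁻¹) ^ p.toReal * ∑ i ∈ Finset.range k, ((w * w) ^ i) ^ p.toReal * ∫⁻ x, (u i x) ^ p.toReal ∂μ := by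
          rw [lintegral_const_mul _ (by fun_prop), lintegral_finsetSum _ (by fun_prop)]
          congr 1
          refine Finset.sum_congr rfl fun i _ => ?_
          rw [lintegral_const_mul _ (by fun_prop)]
      _ ≤ ((1 - w * w)⁻¹) ^ p.toReal * ∑ i ∈ Finset.range k, (w ^ p.toReal) ^ i * T ^ p.toReal := by
          refine mul_le_mul_right (Finset.sum_le_sum fun i hi => ?_) _
          have h1 : ∫⁻ x, (u i x) ^ p.toReal ∂μ ≤ b i ^ p.toReal := by
            have := hb i hi
            rw [eLpNorm_eq_lintegral_rpow_enorm_toReal hp.ne' hpt, one_div, ENNReal.rpow_inv_le_iff hp'] at this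
            simpa only [enorm_eq_self] using this
          calc _ ≤ ((w * w) ^ i) ^ p.toReal * b i ^ p.toReal := by gcongr
            _ = (w ^ p.toReal) ^ i * (w ^ i * b i) ^ p.toReal := by
                rw [mul_pow, ENNReal.mul_rpow_of_nonneg _ _ hp'.le, ENNReal.mul_rpow_of_nonneg _ _ hp'.le,
                  ← mul_assoc]
                congr 2
                rw [← ENNReal.rpow_natCast, ← ENNReal.rpow_natCast, ← ENNReal.rpow_mul, ← ENNReal.rpow_mul, mul_comm]
            _ ≤ _ := by
                gcongr
                exact le_iSup₂ (f := fun i (_ : i ∈ Finset.range k) => w ^ i * b i) i hi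
      _ ≤ ((1 - w * w)⁻¹) ^ p.toReal * ((1 - w ^ p.toReal)⁻¹ * T ^ p.toReal) := by
          rw [← Finset.sum_mul]
          gcongr
          exact geom_sum_le _ _
      _ = _ := by
          rw [ENNReal.mul_rpow_of_nonneg _ _ hp'.le, ENNReal.mul_rpow_of_nonneg _ _ hp'.le, ← ENNReal.rpow_mul,
            inv_mul_cancel₀ hp'.ne', ENNReal.rpow_one, mul_assoc]

/-- Discrete convolution with a geometric sequence in `ℓ_q`, all `0 < q ≤ ∞`. -/
lemma lq_geom {q : ℝ≥0∞} (hq : 0 < q) {w : ℝ≥0∞} (hw : w < 1) :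
    ∃ C : ℝ≥0∞, C ≠ ∞ ∧ ∀ (K : ℝ≥0∞) (a e : ℕ → ℝ≥0∞),
      (∀ k, e k ≤ K * ⨆ i ∈ Finset.range (k + 1), w ^ i * a (k - i)) →
      lqNorm q e ≤ K * C * lqNorm q a := by
  by_cases hqt : q = ∞
  · subst hqt
    refine ⟨1, by simp, fun K a e h => ?_⟩
    simp only [lqNorm, if_true, mul_one]
    refine iSup_le fun k => (h k).trans (mul_le_mul_right ?_ K)
    refine iSup₂_le fun i hi => ?_
    calc w ^ i * a (k - i) ≤ 1 * a (k - i) := by gcongr; exact pow_le_one' hw.le i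
      _ = a (k - i) := one_mul _
      _ ≤ _ := le_iSup a _
  · have hq' : 0 < q.toReal := ENNReal.toReal_pos hq.ne' hqt
    have hwq : w ^ q.toReal < 1 := ENNReal.rpow_lt_one hw hq'
    refine ⟨((1 - w ^ q.toReal)⁻¹) ^ (1 / q.toReal),
        (ENNReal.rpow_ne_top_of_nonneg (by positivity) (inv_one_sub_ne_top hwq)), fun K a e h => ?_⟩
    simp only [lqNorm, if_neg hqt]
    rw [one_div, ENNReal.rpow_inv_le_iff hq']
    calc ∑' k, e k ^ q.toReal ≤ ∑' k, K ^ q.toReal * ∑ x ∈ Finset.HasAntidiagonal.antidiagonal k, (w ^ q.toReal) ^ x.1 * a x.2 ^ q.toReal := by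
          refine ENNReal.tsum_le_tsum fun k => ?_
          calc e k ^ q.toReal ≤ (K * ⨆ i ∈ Finset.range (k + 1), w ^ i * a (k - i)) ^ q.toReal := by
                gcongr; exact h k
            _ = K ^ q.toReal * (⨆ i ∈ Finset.range (k + 1), w ^ i * a (k - i)) ^ q.toReal :=
                ENNReal.mul_rpow_of_nonneg _ _ hq'.le
            _ ≤ K ^ q.toReal * ∑ i ∈ Finset.range (k + 1), (w ^ i * a (k - i)) ^ q.toReal := by
                gcongr; exact iSup_finset_rpow_le _ _ hq'
            _ = _ := by
                rw [Finset.Nat.sum_antidiagonal_eq_sum_range_succ_mk]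
                congr 1
                refine Finset.sum_congr rfl fun i _ => ?_
                rw [ENNReal.mul_rpow_of_nonneg _ _ hq'.le]
                congr 1
                rw [← ENNReal.rpow_natCast, ← ENNReal.rpow_natCast, ← ENNReal.rpow_mul, ← ENNReal.rpow_mul, mul_comm]
      _ = K ^ q.toReal * ∑' x : ℕ × ℕ, (w ^ q.toReal) ^ x.1 * a x.2 ^ q.toReal := by
          rw [ENNReal.tsum_mul_left]
          congr 1
          rw [← (Finset.HasAntidiagonal.sigmaAntidiagonalEquivProd (A := ℕ)).tsum_eq, ENNReal.tsum_sigma']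
          refine tsum_congr fun k => ?_
          rw [tsum_fintype, ← Finset.sum_coe_sort]
          rfl
      _ = K ^ q.toReal * ((1 - w ^ q.toReal)⁻¹ * ∑' k, a k ^ q.toReal) := by
          rw [ENNReal.tsum_prod (f := fun i j => (w ^ q.toReal) ^ i * a j ^ q.toReal)]
          simp_rw [ENNReal.tsum_mul_left]
          rw [ENNReal.tsum_mul_right, ENNReal.tsum_geometric]
      _ = _ := by
          rw [ENNReal.mul_rpow_of_nonneg _ _ hq'.le, ENNReal.mul_rpow_of_nonneg _ _ hq'.le, ← ENNReal.rpow_mul,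
            ← ENNReal.rpow_mul,
            inv_mul_cancel₀ hq'.ne', ENNReal.rpow_one, ENNReal.rpow_one, mul_assoc]

/-- Index of a dyadic cube containing `x`. -/
def flr (n k : ℕ) (x : Fin n → ℝ) : Fin n → ℤ := fun i => ⌊x i * 2 ^ k⌋

/-- Finite set of shifts. -/
def shifts (n c : ℕ) : Finset (Fin n → ℤ) := Finset.Icc (fun _ => -(c : ℤ)) (fun _ => (c : ℤ))

lemma mem_shifts {n c : ℕ} {e : Fin n → ℤ} : e ∈ shifts n c ↔ ∀ i, |e i| ≤ c := by
  simp only [shifts, Finset.mem_Icc, Pi.le_def, abs_le]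
  exact forall_and.symm

lemma mem_cube_flr (n k : ℕ) (x : Fin n → ℝ) : x ∈ dyadicCube n k (flr n k x) := by
  intro i
  have h2 : (0 : ℝ) < 2 ^ k := by positivity
  rw [div_le_iff₀ h2, le_div_iff₀ h2]
  exact ⟨Int.floor_le _, (Int.lt_floor_add_one _).le⟩

lemma flr_near {n k c : ℕ} {x y : Fin n → ℝ} (h : 2 ^ k * ‖x - y‖ ≤ (c : ℝ)) :
    flr n k y - flr n k x ∈ shifts n c := by
  rw [mem_shifts]
  intro i
  have h1 : |x i * 2 ^ k - y i * 2 ^ k| ≤ c := by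
    rw [← sub_mul, abs_mul, abs_of_pos (by positivity : (0 : ℝ) < 2 ^ k), mul_comm]
    refine le_trans ?_ h
    gcongr
    exact norm_le_pi_norm (x - y) i
  rw [abs_le] at h1
  have h2 : ⌊y i * 2 ^ k⌋ ≤ ⌊x i * 2 ^ k⌋ + c := by
    rw [← Int.floor_add_natCast]
    exact Int.floor_le_floor (by linarith)
  have h3 : ⌊x i * 2 ^ k⌋ ≤ ⌊y i * 2 ^ k⌋ + c := by
    rw [← Int.floor_add_natCast]
    exact Int.floor_le_floor (by linarith)
  rw [abs_le]
  simp only [Pi.sub_apply, flr]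
  omega

lemma flr_measurable (n k : ℕ) : Measurable (flr n k) := by
  unfold flr
  refine measurable_pi_lambda _ fun i => ?_
  exact Int.measurable_floor.comp ((measurable_pi_apply i).mul_const _)

lemma cube_measurable (n k : ℕ) (m : Fin n → ℤ) : MeasurableSet (dyadicCube n k m) := by
  have : dyadicCube n k m = Set.Icc (fun i => (m i : ℝ) / 2 ^ k) (fun i => ((m i : ℝ) + 1) / 2 ^ k) := by
    ext x; simp only [dyadicCube, Set.mem_ofPred_eq, Set.mem_Icc, Pi.le_def]; exact forall_and
  rw [this]; exact measurableSet_Icc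

lemma cube_volume (n k : ℕ) (m : Fin n → ℤ) : volume (dyadicCube n k m) = ((2 : ℝ≥0∞) ^ (k * n))⁻¹ := by
  have : dyadicCube n k m = Set.Icc (fun i => (m i : ℝ) / 2 ^ k) (fun i => ((m i : ℝ) + 1) / 2 ^ k) := by
    ext x; simp only [dyadicCube, Set.mem_ofPred_eq, Set.mem_Icc, Pi.le_def]; exact forall_and
  rw [this, Real.volume_Icc_pi]
  have : ∀ i, ENNReal.ofReal (((m i : ℝ) + 1) / 2 ^ k - (m i : ℝ) / 2 ^ k) = ((2 : ℝ≥0∞) ^ k)⁻¹ := fun i => by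
    rw [← sub_div, add_sub_cancel_left, one_div, ENNReal.ofReal_inv_of_pos (by positivity),
      ENNReal.ofReal_pow (by norm_num)]
    simp
  simp only [this, Finset.prod_const, Finset.card_univ, Fintype.card_fin]
  rw [← ENNReal.inv_pow, pow_mul]

lemma t_near {n : ℕ} {p : ℝ≥0∞} {t : ℕ → (Fin n → ℝ) → ℝ} {D : ℝ≥0∞} {k : ℕ}
    (h : ∀ (m m' : Fin n → ℤ), (∀ i, |m i - m' i| ≤ 1) → tkm n p t k m ≤ D * tkm n p t k m') (c : ℕ) :
    ∀ m e : Fin n → ℤ, e ∈ shifts n c → tkm n p t k m ≤ D ^ c * tkm n p t k (m + e) := by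
  induction c with
  | zero =>
    intro m e he
    rw [mem_shifts] at he
    have : e = 0 := by funext i; simpa using he i
    simp [this]
  | succ c ih =>
    intro m e he
    rw [mem_shifts] at he
    have h1 := h m (m + fun i => (e i).sign) (fun i => by
      simp only [Pi.add_apply]
      rcases lt_trichotomy (e i) 0 with h0 | h0 | h0
      · simp [Int.sign_eq_neg_one_of_neg h0]
      · simp [h0]
      · simp [Int.sign_eq_one_of_pos h0])
    have h2 := ih (m + fun i => (e i).sign) (e - fun i => (e i).sign) (by
      rw [mem_shifts]
      intro i
      have := he i
      simp only [Pi.sub_apply]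
      push_cast at this
      rw [abs_le] at this ⊢
      rcases lt_trichotomy (e i) 0 with h0 | h0 | h0
      · rw [Int.sign_eq_neg_one_of_neg h0]; omega
      · simp [h0]
      · rw [Int.sign_eq_one_of_pos h0]; omega)
    rw [add_add_sub_cancel] at h2
    calc _ ≤ _ := h1
      _ ≤ D * (D ^ c * tkm n p t k (m + e)) := by gcongr
      _ = _ := by rw [← mul_assoc, pow_succ']

lemma g_le_seqMax {n : ℕ} (g : ℕ → (Fin n → ℝ) → ℝ) (A : ℝ) {j l : ℕ} (hl : l ≤ j) (y : Fin n → ℝ) :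
    ENNReal.ofReal ((2 : ℝ) ^ (A * ((l : ℝ) - j)) * |g j y|) ≤ seqMax n g A l (flr n l y) :=
  le_iSup₂_of_le (f := fun (k : ℕ) (_ : l ≤ k) => ⨆ y' ∈ dyadicCube n l (flr n l y),
    ENNReal.ofReal ((2 : ℝ) ^ (A * ((l : ℝ) - (k : ℝ))) * |g k y'|)) j hl
    (le_iSup₂_of_le (f := fun y' (_ : y' ∈ dyadicCube n l (flr n l y)) =>
      ENNReal.ofReal ((2 : ℝ) ^ (A * ((l : ℝ) - (j : ℝ))) * |g j y'|)) y (mem_cube_flr n l y) le_rfl)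

lemma g_enorm_le {n : ℕ} (g : ℕ → (Fin n → ℝ) → ℝ) (A : ℝ) {j l : ℕ} (hl : l ≤ j) (y : Fin n → ℝ) :
    ‖g j y‖ₑ ≤ ENNReal.ofReal ((2 : ℝ) ^ (A * ((j : ℝ) - l))) * seqMax n g A l (flr n l y) := by
  calc ‖g j y‖ₑ = ENNReal.ofReal ((2 : ℝ) ^ (A * ((j : ℝ) - l))) *
        ENNReal.ofReal ((2 : ℝ) ^ (A * ((l : ℝ) - j)) * |g j y|) := by
        rw [← ENNReal.ofReal_mul (by positivity), ← mul_assoc, ← Real.rpow_add (by norm_num)]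
        have : A * ((j : ℝ) - l) + A * ((l : ℝ) - j) = 0 := by ring
        rw [this, Real.rpow_zero, one_mul, Real.enorm_eq_ofReal_abs]
    _ ≤ _ := by gcongr; exact g_le_seqMax g A hl y

lemma tk_Lp {n : ℕ} {p σ₂ : ℝ≥0∞} {t : ℕ → (Fin n → ℝ) → ℝ} (ht : ∀ k, Measurable (t k))
    (hσ : p ≤ σ₂) {K : ℝ≥0∞} {j k : ℕ} (m : Fin n → ℤ)
    (h : ((2 : ℝ≥0∞) ^ (j * n)) ^ σ₂⁻¹.toReal *
        eLpNorm (t k) σ₂ (volume.restrict (dyadicCube n j m))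
      ≤ K * (((2 : ℝ≥0∞) ^ (j * n)) ^ p⁻¹.toReal * tkm n p t j m)) :
    eLpNorm (t k) p (volume.restrict (dyadicCube n j m)) ≤ K * tkm n p t j m := by
  have h1 := eLpNorm_le_eLpNorm_mul_rpow_measure_univ (μ := volume.restrict (dyadicCube n j m)) hσ
    (ht k).aestronglyMeasurable
  rw [Measure.restrict_apply_univ, cube_volume] at h1
  set W := (2 : ℝ≥0∞) ^ (j * n) with hW
  have hW0 : W ≠ 0 := by rw [hW]; positivity
  have hWt : W ≠ ∞ := by rw [hW]; exact ENNReal.pow_ne_top (by norm_num)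
  have e : W⁻¹ ^ (1 / p.toReal - 1 / σ₂.toReal) = W ^ σ₂⁻¹.toReal * W ^ (-p⁻¹.toReal) := by
    rw [ENNReal.inv_rpow, ← ENNReal.rpow_neg, ← ENNReal.rpow_add _ _ hW0 hWt, ENNReal.toReal_inv, ENNReal.toReal_inv]
    congr 1; ring
  rw [e] at h1
  calc _ ≤ _ := h1
    _ = (W ^ σ₂⁻¹.toReal * eLpNorm (t k) σ₂ (volume.restrict (dyadicCube n j m))) * W ^ (-p⁻¹.toReal) := by ring
    _ ≤ (K * (W ^ p⁻¹.toReal * tkm n p t j m)) * W ^ (-p⁻¹.toReal) := by gcongr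
    _ = K * tkm n p t j m * (W ^ p⁻¹.toReal * W ^ (-p⁻¹.toReal)) := by ring
    _ = _ := by rw [← ENNReal.rpow_add _ _ hW0 hWt, add_neg_cancel, ENNReal.rpow_zero, mul_one]

/-- Local maximal function. -/
def locMax (n c j : ℕ) (G : (Fin n → ℤ) → ℝ≥0∞) (x : Fin n → ℝ) : ℝ≥0∞ :=
  ⨆ e ∈ shifts n c, G (flr n j x + e)

lemma locMax_measurable (n c j : ℕ) (G : (Fin n → ℤ) → ℝ≥0∞) : Measurable (locMax n c j G) :=
  (measurable_from_top (f := fun m : Fin n → ℤ => ⨆ e ∈ shifts n c, G (m + e))).comp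
    ((flr_measurable n j).mono le_rfl (by
      intro s _; exact (Set.to_countable s).measurableSet))

lemma weighted_bound (n c : ℕ) {p : ℝ≥0∞} (hp : 0 < p) {D : ℝ≥0∞} (hD : D ≠ ∞) :
    ∃ C : ℝ≥0∞, C ≠ ∞ ∧ ∀ (t : ℕ → (Fin n → ℝ) → ℝ) (j k : ℕ) (K : ℝ≥0∞) (G : (Fin n → ℤ) → ℝ≥0∞),
      (∀ (m m' : Fin n → ℤ), (∀ i, |m i - m' i| ≤ 1) → tkm n p t j m ≤ D * tkm n p t j m') →
      (∀ m, eLpNorm (t k) p (volume.restrict (dyadicCube n j m)) ≤ K * tkm n p t j m) →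
      Measurable (t k) →
      eLpNorm (fun x => ‖t k x‖ₑ * locMax n c j G x) p volume ≤
        C * K * lpSum p (fun m => tkm n p t j m * G m) := by
  by_cases hpt : p = ∞
  · subst hpt
    refine ⟨D ^ c, ENNReal.pow_ne_top hD, fun t j k K G h1 h2 h3 => ?_⟩
    rw [eLpNorm_exponent_top]
    apply eLpNormEssSup_le_of_ae_enorm_bound
    have : ∀ᵐ x : Fin n → ℝ, ∀ m, x ∈ dyadicCube n j m → ‖t k x‖ₑ ≤ K * tkm n ∞ t j m := by
      rw [ae_all_iff]; intro m
      rw [← ae_restrict_iff' (cube_measurable n j m)]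
      have := h2 m
      rw [eLpNorm_exponent_top] at this
      filter_upwards [enorm_ae_le_eLpNormEssSup (t k) (volume.restrict (dyadicCube n j m))] with x hx
      exact hx.trans this
    filter_upwards [this] with x hx
    rw [enorm_eq_self]
    unfold locMax
    rw [ENNReal.mul_iSup]
    refine iSup_le fun e => ?_
    rw [ENNReal.mul_iSup]
    refine iSup_le fun he => ?_
    calc _ ≤ (K * (D ^ c * tkm n ∞ t j (flr n j x + e))) * G (flr n j x + e) := by
          gcongr
          refine (hx _ (mem_cube_flr n j x)).trans ?_
          gcongr
          exact t_near h1 c _ e he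
      _ = D ^ c * K * (tkm n ∞ t j (flr n j x + e) * G (flr n j x + e)) := by ring
      _ ≤ _ := by
          gcongr
          exact le_lpSum hp (fun m => tkm n ∞ t j m * G m) _
  · have hp' : 0 < p.toReal := ENNReal.toReal_pos hp.ne' hpt
    refine ⟨((shifts n c).card : ℝ≥0∞) ^ (1 / p.toReal) * D ^ c, ENNReal.mul_ne_top
      (ENNReal.rpow_ne_top_of_nonneg (by positivity) (ENNReal.natCast_ne_top _)) (ENNReal.pow_ne_top hD),
      fun t j k K G h1 h2 h3 => ?_⟩
    rw [eLpNorm_eq_lintegral_rpow_enorm_toReal hp.ne' hpt]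
    simp only [lpSum, if_neg hpt]
    rw [one_div, ENNReal.rpow_inv_le_iff hp']
    set s : (Fin n → ℤ) → Set (Fin n → ℝ) := fun m => flr n j ⁻¹' {m} with hs
    have hsU : (⋃ m, s m) = Set.univ := by
      ext x; simp [hs]
    have hsm : ∀ m, MeasurableSet (s m) := fun m => flr_measurable n j (Set.to_countable _).measurableSet
    have hsub : ∀ m, s m ⊆ dyadicCube n j m := by
      intro m x hx
      have : flr n j x = m := hx
      rw [← this]; exact mem_cube_flr n j x
    set r := p.toReal with hr
    have hint : ∀ m, ∫⁻ x in dyadicCube n j m, ‖t k x‖ₑ ^ r ≤ (K * tkm n p t j m) ^ r := by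
      intro m
      have := h2 m
      rw [eLpNorm_eq_lintegral_rpow_enorm_toReal hp.ne' hpt, one_div, ENNReal.rpow_inv_le_iff hp'] at this
      exact this
    calc ∫⁻ x, ‖‖t k x‖ₑ * locMax n c j G x‖ₑ ^ r = ∫⁻ x in ⋃ m, s m, (‖t k x‖ₑ * locMax n c j G x) ^ r := by
          rw [hsU, Measure.restrict_univ]; simp only [enorm_eq_self]
      _ ≤ ∑' m, ∫⁻ x in s m, (‖t k x‖ₑ * locMax n c j G x) ^ r := lintegral_iUnion_le _ _
      _ ≤ ∑' m, ∑ e ∈ shifts n c, (K * D ^ c) ^ r * (tkm n p t j (m + e) * G (m + e)) ^ r := by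
          refine ENNReal.tsum_le_tsum fun m => ?_
          calc ∫⁻ x in s m, (‖t k x‖ₑ * locMax n c j G x) ^ r
              = ∫⁻ x in s m, ‖t k x‖ₑ ^ r * (⨆ e ∈ shifts n c, G (m + e)) ^ r := by
                refine setLIntegral_congr_fun (hsm m) fun x hx => ?_
                have : flr n j x = m := hx
                simp only [locMax, this]
                rw [ENNReal.mul_rpow_of_nonneg _ _ hp'.le]
            _ ≤ ∫⁻ x in dyadicCube n j m, ‖t k x‖ₑ ^ r * (⨆ e ∈ shifts n c, G (m + e)) ^ r :=
                lintegral_mono_set (hsub m)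
            _ = (∫⁻ x in dyadicCube n j m, ‖t k x‖ₑ ^ r) * (⨆ e ∈ shifts n c, G (m + e)) ^ r := by
                rw [lintegral_mul_const _ (by fun_prop)]
            _ ≤ (K * tkm n p t j m) ^ r * ∑ e ∈ shifts n c, G (m + e) ^ r := by
                gcongr
                · exact hint m
                · exact iSup_finset_rpow_le _ _ hp'
            _ ≤ _ := by
                rw [Finset.mul_sum]
                refine Finset.sum_le_sum fun e he => ?_
                rw [← ENNReal.mul_rpow_of_nonneg _ _ hp'.le, ← ENNReal.mul_rpow_of_nonneg _ _ hp'.le]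
                gcongr ?_ ^ r
                calc _ ≤ K * (D ^ c * tkm n p t j (m + e)) * G (m + e) := by
                      gcongr; exact t_near h1 c _ e he
                  _ = _ := by ring
      _ = ∑ e ∈ shifts n c, ∑' m, (K * D ^ c) ^ r * (tkm n p t j (m + e) * G (m + e)) ^ r :=
          Summable.tsum_finsetSum fun _ _ => ENNReal.summable
      _ = ∑ e ∈ shifts n c, (K * D ^ c) ^ r * ∑' m, (tkm n p t j m * G m) ^ r := by
          refine Finset.sum_congr rfl fun e _ => ?_
          rw [ENNReal.tsum_mul_left]
          congr 1
          exact (Equiv.addRight e).tsum_eq (fun m => (tkm n p t j m * G m) ^ r)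
      _ = _ := by
          rw [Finset.sum_const, nsmul_eq_mul]
          simp only [ENNReal.mul_rpow_of_nonneg _ _ hp'.le]
          rw [← ENNReal.rpow_mul, ← ENNReal.rpow_mul,
            inv_mul_cancel₀ hp'.ne', ENNReal.rpow_one, ENNReal.rpow_one]
          ring

/-- Growth of `g`. -/
lemma g_growth {n : ℕ} {p : ℝ≥0∞} (hp : 0 < p) {t : ℕ → (Fin n → ℝ) → ℝ} {α₃ : ℝ} (hα₃ : 0 ≤ α₃)
    (h : ∀ (m m' : Fin n → ℤ), (∀ i, |m i - m' i| ≤ 1) →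
      tkm n p t 0 m ≤ ENNReal.ofReal (2 ^ α₃) * tkm n p t 0 m')
    (hpos : 0 < tkm n p t 0 0) (hfin : tkm n p t 0 0 ≠ ∞) (A : ℝ) {g : ℕ → (Fin n → ℝ) → ℝ}
    (ha : lpSum p (fun m : Fin n → ℤ => tkm n p t 0 m * seqMax n g A 0 m) ≠ ∞) :
    ∃ B : ℝ, ∀ j y, |g j y| ≤ B * (2 : ℝ) ^ (A * j) * Real.exp (⌈α₃⌉₊ * ‖y‖) := by
  set a := lpSum p (fun m : Fin n → ℤ => tkm n p t 0 m * seqMax n g A 0 m) with hadef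
  refine ⟨a.toReal / (tkm n p t 0 0).toReal * Real.exp (⌈α₃⌉₊ * 2), fun j y => ?_⟩
  set c := ⌈‖y‖⌉₊ + 1 with hc
  have hcy : (c : ℝ) ≤ ‖y‖ + 2 := by
    rw [hc]; push_cast
    linarith [(Nat.ceil_lt_add_one (norm_nonneg y)).le]
  have h1 : flr n 0 y ∈ shifts n c := by
    have := flr_near (n := n) (k := 0) (c := c) (x := 0) (y := y) (by
      rw [hc]; push_cast
      simp only [pow_zero, zero_sub, norm_neg, one_mul]
      linarith [Nat.le_ceil ‖y‖])
    have h0 : flr n 0 (0 : Fin n → ℝ) = 0 := by funext i; simp [flr]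
    rwa [h0, sub_zero] at this
  have h2 := t_near h c 0 _ h1
  rw [zero_add] at h2
  have h3 := le_lpSum hp (fun m : Fin n → ℤ => tkm n p t 0 m * seqMax n g A 0 m) (flr n 0 y)
  rw [← hadef] at h3
  have h4 := g_enorm_le g A (Nat.zero_le j) y
  have h5 : tkm n p t 0 0 * ‖g j y‖ₑ ≤ ENNReal.ofReal (2 ^ α₃) ^ c * ENNReal.ofReal ((2 : ℝ) ^ (A * j)) * a := by
    calc _ ≤ (ENNReal.ofReal (2 ^ α₃) ^ c * tkm n p t 0 (flr n 0 y)) *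
          (ENNReal.ofReal ((2 : ℝ) ^ (A * ((j : ℝ) - (0 : ℕ)))) * seqMax n g A 0 (flr n 0 y)) := by gcongr
      _ = ENNReal.ofReal (2 ^ α₃) ^ c * ENNReal.ofReal ((2 : ℝ) ^ (A * j)) *
          (tkm n p t 0 (flr n 0 y) * seqMax n g A 0 (flr n 0 y)) := by
          rw [Nat.cast_zero, sub_zero]; ring
      _ ≤ _ := by gcongr
  have h6 := ENNReal.toReal_mono (by
    exact ENNReal.mul_ne_top (ENNReal.mul_ne_top (ENNReal.pow_ne_top ENNReal.ofReal_ne_top) ENNReal.ofReal_ne_top) ha) h5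
  simp only [ENNReal.toReal_mul, ENNReal.toReal_pow, toReal_enorm, Real.norm_eq_abs] at h6
  rw [ENNReal.toReal_ofReal (by positivity), ENNReal.toReal_ofReal (by positivity)] at h6
  have hτ : 0 < (tkm n p t 0 0).toReal := ENNReal.toReal_pos hpos.ne' hfin
  have h7 : ((2 : ℝ) ^ α₃) ^ c ≤ Real.exp (⌈α₃⌉₊ * 2) * Real.exp (⌈α₃⌉₊ * ‖y‖) := by
    have e1 : (2 : ℝ) ^ α₃ ≤ Real.exp α₃ := by
      rw [← Real.exp_one_rpow α₃]
      gcongr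
      have := Real.add_one_le_exp 1
      linarith
    calc ((2 : ℝ) ^ α₃) ^ c ≤ (Real.exp α₃) ^ c := by gcongr
      _ = Real.exp (c * α₃) := by rw [← Real.exp_nat_mul]
      _ ≤ Real.exp ((‖y‖ + 2) * ⌈α₃⌉₊) := by
          gcongr
          exact Nat.le_ceil _
      _ = _ := by rw [← Real.exp_add]; congr 1; ring
  rw [mul_comm, ← le_div_iff₀ hτ] at h6
  calc _ ≤ _ := h6
    _ ≤ (Real.exp (⌈α₃⌉₊ * 2) * Real.exp (⌈α₃⌉₊ * ‖y‖)) * (2 : ℝ) ^ (A * j) * a.toReal / (tkm n p t 0 0).toReal := by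
        gcongr
    _ = _ := by ring

/-- One term of the convolution series. -/
lemma term_bound {n c : ℕ} (g : ℕ → (Fin n → ℝ) → ℝ) (A : ℝ) {j l : ℕ} (hl : l ≤ j)
    (x : Fin n → ℝ) (κ : (Fin n → ℝ) → ℝ) {E : ℝ} (hE : 0 ≤ E) (hκ : ∀ y, |κ y| ≤ E)
    (hκ0 : ∀ y, (c : ℝ) < 2 ^ l * ‖x - y‖ → κ y = 0) :
    ‖∫ y, g j y * κ y‖ₑ ≤ ENNReal.ofReal (E * (2 * (c / 2 ^ l)) ^ n *
      (2 : ℝ) ^ (A * ((j : ℝ) - l))) * locMax n c l (seqMax n g A l) x := by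
  set H := locMax n c l (seqMax n g A l) x with hH
  have hpt : ∀ y, ‖g j y * κ y‖ₑ ≤ (Metric.closedBall x (c / 2 ^ l)).indicator
      (fun _ => ENNReal.ofReal (E * (2 : ℝ) ^ (A * ((j : ℝ) - l))) * H) y := by
    intro y
    by_cases hy : (c : ℝ) < 2 ^ l * ‖x - y‖
    · rw [hκ0 y hy]; simp
    · push Not at hy
      have hmem : y ∈ Metric.closedBall x (c / 2 ^ l) := by
        rw [Metric.mem_closedBall, dist_comm, dist_eq_norm, le_div_iff₀ (by positivity), mul_comm]
        exact hy
      rw [Set.indicator_of_mem hmem, enorm_mul]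
      have h1 := g_enorm_le g A hl y
      have h2 : seqMax n g A l (flr n l y) ≤ H := by
        have := flr_near hy
        have h3 : flr n l y = flr n l x + (flr n l y - flr n l x) := by abel
        rw [hH, locMax]
        conv_lhs => rw [h3]
        exact le_iSup₂ (f := fun e (_ : e ∈ shifts n c) => seqMax n g A l (flr n l x + e)) _ this
      have h4 : ‖κ y‖ₑ ≤ ENNReal.ofReal E := by
        rw [Real.enorm_eq_ofReal_abs]; exact ENNReal.ofReal_le_ofReal (hκ y)
      calc ‖g j y‖ₑ * ‖κ y‖ₑ ≤ (ENNReal.ofReal ((2 : ℝ) ^ (A * ((j : ℝ) - l))) * H) * ENNReal.ofReal E := by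
            gcongr; exact h1.trans (by gcongr)
        _ = _ := by rw [ENNReal.ofReal_mul hE]; ring
  calc ‖∫ y, g j y * κ y‖ₑ ≤ ∫⁻ y, ‖g j y * κ y‖ₑ := enorm_integral_le_lintegral_enorm _
    _ ≤ ∫⁻ y, (Metric.closedBall x (c / 2 ^ l)).indicator
      (fun _ => ENNReal.ofReal (E * (2 : ℝ) ^ (A * ((j : ℝ) - l))) * H) y := lintegral_mono hpt
    _ = _ := by
      rw [lintegral_indicator measurableSet_closedBall, lintegral_const, Measure.restrict_apply_univ,
        Real.volume_pi_closedBall _ (by positivity), Fintype.card_fin]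
      rw [mul_right_comm, ← ENNReal.ofReal_mul (by positivity)]
      congr 2
      ring

lemma rpow_nat_mul_ofReal (a : ℝ) (i : ℕ) :
    ENNReal.ofReal ((2 : ℝ) ^ a) ^ i = ENNReal.ofReal ((2 : ℝ) ^ (a * i)) := by
  rw [← ENNReal.ofReal_pow (by positivity), Real.rpow_mul_natCast (by norm_num)]

/-- Summation of the pointwise bounds. -/
lemma split_sum (S H : ℕ → ℝ≥0∞) (P v v' : ℝ≥0∞) (k : ℕ)
    (h1 : ∀ i, S (i + k) ≤ P * v ^ i * H k) (h2 : ∀ j, j < k → S j ≤ P * v' ^ (k - j) * H j) :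
    ∑' j, S j ≤ P * (1 - v)⁻¹ * ∑ i ∈ Finset.range (k + 1), v' ^ i * H (k - i) := by
  have e : ∑ i ∈ Finset.range (k + 1), v' ^ i * H (k - i) =
      ∑ j ∈ Finset.range (k + 1), v' ^ (k - j) * H j := by
    rw [← Finset.sum_range_reflect]
    refine Finset.sum_congr rfl fun i hi => ?_
    have : i ≤ k := Nat.lt_succ_iff.mp (Finset.mem_range.mp hi)
    simp only [Nat.add_sub_cancel]
    rw [Nat.sub_sub_self this]
  have h1' : 1 ≤ (1 - v)⁻¹ := ENNReal.one_le_inv.2 tsub_le_self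
  rw [e, ← ENNReal.summable.sum_add_tsum_nat_add' (k := k), Finset.sum_range_succ, mul_add]
  refine add_le_add ?_ ?_
  · rw [Finset.mul_sum]
    refine Finset.sum_le_sum fun j hj => (h2 j (Finset.mem_range.mp hj)).trans ?_
    calc P * v' ^ (k - j) * H j = P * 1 * (v' ^ (k - j) * H j) := by ring
      _ ≤ _ := by gcongr
  · calc ∑' i, S (i + k) ≤ ∑' i, P * v ^ i * H k := ENNReal.tsum_le_tsum h1
      _ = _ := by
        rw [ENNReal.tsum_mul_right, ENNReal.tsum_mul_left, ENNReal.tsum_geometric]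
        simp

lemma shift_test {n : ℕ} {φ : (Fin n → ℝ) → ℝ} (h : IsTestFun n φ) (x : Fin n → ℝ) :
    IsTestFun n (fun y => φ (x - y)) := by
  refine ⟨h.1.comp (contDiff_const.sub contDiff_id), ?_⟩
  exact h.2.comp_homeomorph (Homeomorph.subLeft x)

/-- Pointwise estimate for the convolution series. -/
lemma pointwise_bound {n c : ℕ} {φ₀ ψ₀ ψ : (Fin n → ℝ) → ℝ} {C A : ℝ} (hC : 0 < C) {M M' : ℕ}
    (H : ∀ (j k : ℕ) (x y : Fin n → ℝ),
      (k ≤ j → |∫ z, kernFam n ψ₀ ψ j (z - y) * phiFam n φ₀ k (x - z)| ≤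
        C * 2 ^ (k * n) * ((2 : ℝ) ^ k / 2 ^ j) ^ M ∧
        ((c : ℝ) < 2 ^ k * ‖x - y‖ → ∫ z, kernFam n ψ₀ ψ j (z - y) * phiFam n φ₀ k (x - z) = 0)) ∧
      (j < k → |∫ z, kernFam n ψ₀ ψ j (z - y) * phiFam n φ₀ k (x - z)| ≤
        C * 2 ^ (j * n) * ((2 : ℝ) ^ j / 2 ^ k) ^ M' ∧
        ((c : ℝ) < 2 ^ j * ‖x - y‖ → ∫ z, kernFam n ψ₀ ψ j (z - y) * phiFam n φ₀ k (x - z) = 0)))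
    (g : ℕ → (Fin n → ℝ) → ℝ) (k : ℕ) (x : Fin n → ℝ) :
    ‖∑' j, ∫ y, g j y * ∫ z, kernFam n ψ₀ ψ j (z - y) * phiFam n φ₀ k (x - z)‖ₑ ≤
      ENNReal.ofReal (C * (2 * c) ^ n) * (1 - ENNReal.ofReal ((2 : ℝ) ^ (A - M)))⁻¹ *
        ∑ i ∈ Finset.range (k + 1), ENNReal.ofReal ((2 : ℝ) ^ (-(M' : ℝ))) ^ i *
          locMax n c (k - i) (seqMax n g A (k - i)) x := by
  refine enorm_tsum_le_tsum_enorm.trans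
    (split_sum _ (fun j => locMax n c j (seqMax n g A j) x) _ _ _ k ?_ ?_)
  · intro i
    have hk : k ≤ i + k := Nat.le_add_left _ _
    refine (term_bound (c := c) g A hk x _ (E := C * 2 ^ (k * n) * ((2 : ℝ) ^ k / 2 ^ (i + k)) ^ M)
      (by positivity) (fun y => ((H (i + k) k x y).1 hk).1)
      (fun y => ((H (i + k) k x y).1 hk).2)).trans (le_of_eq ?_)
    rw [rpow_nat_mul_ofReal, ← ENNReal.ofReal_mul (by positivity)]
    congr 2
    have e1 : ((2 : ℝ) ^ k / 2 ^ (i + k)) ^ M = (2 : ℝ) ^ (-(M : ℝ) * i) := by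
      rw [neg_mul, Real.rpow_neg (by norm_num), ← Nat.cast_mul, Real.rpow_natCast, pow_add]
      rw [div_mul_cancel_right₀ (by positivity), inv_pow, ← pow_mul, mul_comm]
    have e2 : (A * (((i + k : ℕ) : ℝ) - k)) = A * i := by push_cast; ring
    have e3 : (A - M) * i = -(M : ℝ) * i + A * i := by ring
    rw [e1, e2, e3, Real.rpow_add (by norm_num), mul_pow, div_pow, mul_pow, pow_mul]
    field_simp
  · intro j hj
    refine (term_bound (c := c) g A (le_refl j) x _ (E := C * 2 ^ (j * n) * ((2 : ℝ) ^ j / 2 ^ k) ^ M')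
      (by positivity) (fun y => ((H j k x y).2 hj).1)
      (fun y => ((H j k x y).2 hj).2)).trans (le_of_eq ?_)
    rw [rpow_nat_mul_ofReal, ← ENNReal.ofReal_mul (by positivity)]
    congr 2
    obtain ⟨i, rfl⟩ := Nat.exists_eq_add_of_lt hj
    have e0 : j + i + 1 - j = i + 1 := by omega
    have e1 : ((2 : ℝ) ^ j / 2 ^ (j + i + 1)) ^ M' = (2 : ℝ) ^ (-(M' : ℝ) * ((i + 1 : ℕ) : ℝ)) := by
      rw [neg_mul, Real.rpow_neg (by norm_num), ← Nat.cast_mul, Real.rpow_natCast, add_assoc, pow_add]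
      rw [div_mul_cancel_left₀ (by positivity), inv_pow, ← pow_mul, mul_comm]
    rw [e0, e1, sub_self, mul_zero, Real.rpow_zero, mul_one, mul_pow, div_pow, mul_pow, pow_mul]
    field_simp

lemma eLpNorm_const_mul_bound {X : Type*} [MeasurableSpace X] {ε ε' : Type*}
    [TopologicalSpace ε] [ContinuousENorm ε] [TopologicalSpace ε'] [ContinuousENorm ε']
    {μ : Measure X} {p P : ℝ≥0∞}
    (hP : P ≠ ∞) {f : X → ε} {u : X → ε'} (h : ∀ x, ‖f x‖ₑ ≤ P * ‖u x‖ₑ) :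
    eLpNorm f p μ ≤ P * eLpNorm u p μ := by
  obtain ⟨a, rfl⟩ : ∃ a : NNReal, P = (a : ℝ≥0∞) := ⟨P.toNNReal, (ENNReal.coe_toNNReal hP).symm⟩
  have h' : ∀ᵐ x ∂μ, ‖f x‖ₑ ≤ (a : ℝ≥0∞) * ‖u x‖ₑ := Eventually.of_forall h
  have := eLpNorm_le_mul_eLpNorm_of_ae_le_mul' (μ := μ) (f := f) (g := u) (c := a) h' p
  exact this

/-- The estimate at each level `k`. -/
lemma level_bound {n c : ℕ} {p σ₂ : ℝ≥0∞} (hp : 0 < p) (hσ : p ≤ σ₂) {t : ℕ → (Fin n → ℝ) → ℝ}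
    (htm : ∀ k, Measurable (t k)) {α₂ α₃ C₂ : ℝ}
    (h2 : ∀ k j : ℕ, k ≤ j → ∀ m : Fin n → ℤ,
      ((2 : ℝ≥0∞) ^ (k * n)) ^ σ₂⁻¹.toReal *
        eLpNorm (t j) σ₂ (volume.restrict (dyadicCube n k m))
      ≤ ENNReal.ofReal (C₂ * 2 ^ (α₂ * ((j : ℝ) - (k : ℝ)))) *
        (((2 : ℝ≥0∞) ^ (k * n)) ^ p⁻¹.toReal * tkm n p t k m))
    (h3 : ∀ (k : ℕ) (m m' : Fin n → ℤ), (∀ i, |m i - m' i| ≤ 1) →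
      tkm n p t k m ≤ ENNReal.ofReal (2 ^ α₃) * tkm n p t k m')
    {M' : ℕ} (hM : α₂ < M') :
    ∃ (K w : ℝ≥0∞), K ≠ ∞ ∧ w < 1 ∧ ∀ (P : ℝ≥0∞) (k : ℕ) (G : ℕ → (Fin n → ℤ) → ℝ≥0∞)
      (f : (Fin n → ℝ) → ℝ), P ≠ ∞ →
      (∀ x, ‖f x‖ₑ ≤ P * ∑ i ∈ Finset.range (k + 1), ENNReal.ofReal ((2 : ℝ) ^ (-(M' : ℝ))) ^ i *
          locMax n c (k - i) (G (k - i)) x) →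
      eLpNorm (fun x => t k x * f x) p volume ≤ P * K *
        ⨆ i ∈ Finset.range (k + 1), w ^ i * lpSum p (fun m => tkm n p t (k - i) m * G (k - i) m) := by
  set w := ENNReal.ofReal ((2 : ℝ) ^ ((α₂ - M') / 4)) with hw
  have hw1 : w < 1 := by
    rw [hw, ENNReal.ofReal_lt_one]
    exact Real.rpow_lt_one_of_one_lt_of_neg (by norm_num) (by linarith)
  set β := ENNReal.ofReal ((2 : ℝ) ^ (-α₂)) with hβ
  have hwβ : (w * w) * (w * w) * β = ENNReal.ofReal ((2 : ℝ) ^ (-(M' : ℝ))) := by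
    rw [hw, hβ]
    simp only [← ENNReal.ofReal_mul (show (0:ℝ) ≤ (2 : ℝ) ^ ((α₂ - M') / 4) by positivity)]
    rw [← ENNReal.ofReal_mul (by positivity), ← ENNReal.ofReal_mul (by positivity)]
    simp only [← Real.rpow_add (show (0:ℝ) < 2 by norm_num)]
    congr 2; ring
  obtain ⟨Cw, hCw, HCw⟩ := weighted_bound n c hp (D := ENNReal.ofReal (2 ^ α₃)) ENNReal.ofReal_ne_top
  obtain ⟨Cg, hCg, HCg⟩ := eLpNorm_geom (volume : Measure (Fin n → ℝ)) hp hw1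
  refine ⟨Cg * (Cw * ENNReal.ofReal C₂), w, ENNReal.mul_ne_top hCg (ENNReal.mul_ne_top hCw ENNReal.ofReal_ne_top),
    hw1, fun P k G f hP hf => ?_⟩
  set u : ℕ → (Fin n → ℝ) → ℝ≥0∞ := fun i x => β ^ i * (‖t k x‖ₑ * locMax n c (k - i) (G (k - i)) x) with hu
  have hum : ∀ i, Measurable (u i) := fun i =>
    ((htm k).enorm.mul (locMax_measurable n c _ _)).const_mul _
  have hub : ∀ i ∈ Finset.range (k + 1), eLpNorm (u i) p volume ≤
      (Cw * ENNReal.ofReal C₂) * lpSum p (fun m => tkm n p t (k - i) m * G (k - i) m) := by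
    intro i hi
    have hik : i ≤ k := Nat.lt_succ_iff.mp (Finset.mem_range.mp hi)
    have hβt : β ^ i ≠ ∞ := ENNReal.pow_ne_top ENNReal.ofReal_ne_top
    refine (eLpNorm_const_mul_bound (P := β ^ i) hβt
      (u := fun x => ‖t k x‖ₑ * locMax n c (k - i) (G (k - i)) x) (fun x => le_rfl)).trans ?_
    have := HCw t (k - i) k _ (G (k - i)) (h3 (k - i))
      (fun m => tk_Lp htm hσ m (h2 (k - i) k (Nat.sub_le _ _) m)) (htm k)
    refine (mul_le_mul_right this _).trans (le_of_eq ?_)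
    have e : β ^ i * ENNReal.ofReal (C₂ * 2 ^ (α₂ * ((k : ℝ) - ((k - i : ℕ) : ℝ)))) = ENNReal.ofReal C₂ := by
      rw [hβ, rpow_nat_mul_ofReal, ← ENNReal.ofReal_mul (by positivity), mul_left_comm,
        ← Real.rpow_add (by norm_num), Nat.cast_sub hik]
      have : -α₂ * i + α₂ * ((k : ℝ) - (k - i)) = 0 := by ring
      rw [this, Real.rpow_zero, mul_one]
    rw [← e]; ring
  have hmain : eLpNorm (fun x => t k x * f x) p volume ≤ P *
      eLpNorm (fun x => ∑ i ∈ Finset.range (k + 1), ((w * w) * (w * w)) ^ i * u i x) p volume := by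
    refine eLpNorm_const_mul_bound hP fun x => ?_
    rw [enorm_mul, enorm_eq_self]
    refine (mul_le_mul_right (hf x) _).trans (le_of_eq ?_)
    rw [mul_left_comm, Finset.mul_sum]
    congr 1
    refine Finset.sum_congr rfl fun i _ => ?_
    rw [← hwβ, hu, mul_pow]
    ring
  refine hmain.trans ?_
  rw [mul_assoc P]
  refine mul_le_mul_right ((HCg (k + 1) u _ hum hub).trans (le_of_eq ?_)) _
  rw [mul_assoc Cg]
  congr 1
  simp only [ENNReal.mul_iSup]
  refine iSup_congr fun i => iSup_congr fun _ => ?_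
  ring

/-- Lemma 3.5, convergence and Besov estimate for `Σ_j ψ_j ∗ g^j`. -/
theorem series_convergence_estimate (n : ℕ) (p q σ₁ σ₂ : ℝ≥0∞) (α₁ α₂ α₃ : ℝ)
    (hp : 0 < p) (hq : 0 < q) (hσ₁ : 0 < σ₁) (hσ₂ : 0 < σ₂) (hα₃ : 0 ≤ α₃)
    (t : ℕ → (Fin n → ℝ) → ℝ) (ht : MemX n p σ₁ σ₂ α₁ α₂ α₃ t) (hσ₂p : p ≤ σ₂)
    (φ₀ : (Fin n → ℝ) → ℝ) (hφ₀ : IsTestFun n φ₀) (hint : (∫ x, φ₀ x) = 1)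
    (Lφ : ℤ) (hLφ : -1 ≤ Lφ) (hmomφ : MomentsVanish n Lφ (phiOf n φ₀))
    (hLφα : α₂ < (Lφ : ℝ) + 1)
    (A : ℝ) (hA : 0 < A)
    (ψ₀ ψ : (Fin n → ℝ) → ℝ) (hψ₀ : IsTestFun n ψ₀) (hψ : IsTestFun n ψ)
    (Lψ : ℤ) (hLψ : -1 ≤ Lψ) (hmomψ : MomentsVanish n Lψ ψ)
    (hLψA : A < (Lψ : ℝ) + 1) :
    ∃ C : ℝ, 0 < C ∧ ∀ g : ℕ → (Fin n → ℝ) → ℝ,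
      (∀ k, Measurable (g k)) →
      (∀ (k : ℕ) (R : ℝ), ∃ B : ℝ, ∀ x, ‖x‖ ≤ R → |g k x| ≤ B) →
      lqNorm q (fun j => lpSum p fun m : Fin n → ℤ =>
          tkm n p t j m * seqMax n g A j m) ≠ ∞ →
      ∃ F : Dstrb n,
        (∀ θ : (Fin n → ℝ) → ℝ, ContDiff ℝ (⊤ : ℕ∞) θ →
          (∀ N : ℕ, seSeminorm n N θ ≠ ∞) →
          Filter.Tendsto
            (fun K : ℕ => ∑ j ∈ Finset.range K,
              ∫ x, (∫ y, kernFam n ψ₀ ψ j (x - y) * g j y) * θ x)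
            Filter.atTop (nhds (F θ))) ∧
        besovNorm n p q t φ₀ F ≤
          ENNReal.ofReal C *
            lqNorm q (fun j => lpSum p fun m : Fin n → ℤ =>
              tkm n p t j m * seqMax n g A j m) := by
  obtain ⟨⟨htm, -, hfin⟩, -, ⟨C₂, -, h2⟩, hpos, h3⟩ := ht
  obtain ⟨M, hM⟩ : ∃ M : ℕ, (M : ℤ) = Lψ + 1 := ⟨(Lψ + 1).toNat, Int.toNat_of_nonneg (by omega)⟩
  obtain ⟨M', hM'⟩ : ∃ M : ℕ, (M : ℤ) = Lφ + 1 := ⟨(Lφ + 1).toNat, Int.toNat_of_nonneg (by omega)⟩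
  have hAM : A < M := by
    have : (M : ℝ) = Lψ + 1 := by exact_mod_cast hM
    rw [this]; exact hLψA
  have hαM : α₂ < M' := by
    have : (M' : ℝ) = Lφ + 1 := by exact_mod_cast hM'
    rw [this]; exact hLφα
  obtain ⟨C, c, hC, HK⟩ := kernel_bound hφ₀ hψ₀ hψ hmomφ hmomψ M' M hM'.le hM.le
  obtain ⟨K, w, hK, hw, HL⟩ := level_bound (c := c) hp hσ₂p htm h2 h3 hαM
  obtain ⟨Cq, hCq, HQ⟩ := lq_geom hq hw
  set P := ENNReal.ofReal (C * (2 * c) ^ n) * (1 - ENNReal.ofReal ((2 : ℝ) ^ (A - M)))⁻¹ with hPdef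
  have hP : P ≠ ∞ := by
    refine ENNReal.mul_ne_top ENNReal.ofReal_ne_top (inv_one_sub_ne_top ?_)
    rw [ENNReal.ofReal_lt_one]
    exact Real.rpow_lt_one_of_one_lt_of_neg (by norm_num) (by linarith)
  have hT : P * K * Cq ≠ ∞ := ENNReal.mul_ne_top (ENNReal.mul_ne_top hP hK) hCq
  refine ⟨(P * K * Cq).toReal + 1, by positivity, fun g hg _ hq1 => ?_⟩
  have ha0 : lpSum p (fun m : Fin n → ℤ => tkm n p t 0 m * seqMax n g A 0 m) ≠ ∞ :=
    ne_top_of_le_ne_top hq1 (le_lpSum hq (fun j => lpSum p fun m : Fin n → ℤ =>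
          tkm n p t j m * seqMax n g A j m) 0)
  obtain ⟨B, hB⟩ := g_growth hp hα₃ (h3 0) (hpos 0 0) (hfin 0 0).ne A ha0
  obtain ⟨F, hF⟩ := series_exists hψ₀ hψ hmomψ M hM.le hAM hg hB
  refine ⟨F, fun θ h1 h2 => (hF θ h1 h2).1, ?_⟩
  have hle : P * K * Cq ≤ ENNReal.ofReal ((P * K * Cq).toReal + 1) :=
    (ENNReal.le_ofReal_iff_toReal_le hT (by positivity)).2 (by linarith)
  refine le_trans ?_ (mul_le_mul_left hle _)
  refine HQ (P * K) _ _ fun k => ?_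
  refine HL P k (fun j => seqMax n g A j) _ hP fun x => ?_
  have hθ := shift_test (phiFam_test hφ₀ k) x
  have hval := (hF _ hθ.1 (test_se hθ)).2
  rw [distConv, hval]
  exact pointwise_bound hC HK g k x
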